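/- arXiv:1510.02088 — 3 statements merged into one kernel-verified Lean document; each statement's English description precedes it below -/
import Mathlib

section
/- Let B_1, B_2, B_3 be three closed balls in Euclidean 3-space with centers a_1, a_2, a_3 on the unit sphere (‖a_i‖ = 1) and radii r_1, r_2, r_3 > 0, which are pairwise non-overlapping (dist(a_i, a_j) ≥ r_i + r_j for i ≠ j) and none of which contains the origin (0 ∉ B_i). Then the three balls do not generate the shadow at the center of the sphere: there exists a nonzero vector v ∈ ℝ³ such that the line {t • v : t ∈ ℝ} through the origin intersects none of the three balls. -/
open Metric RealInnerProductSpace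
open scoped Matrix

/-- If three squared radii sum to less than `2`, the Gram determinant of three unit vectors with
pairwise inner products `a`, `b`, `c` is smaller than the weighted sum of its principal minors. -/
theorem gram_det_lt_of_sum_lt {P Q R a b c : ℝ} (hP : 0 < 1 - P) (hQ : 0 < 1 - Q) (hR : 0 < 1 - R)
    (ha : a ^ 2 ≤ 1) (hb : b ^ 2 ≤ 1) (hc : c ^ 2 ≤ 1) (ha1 : a < 1) (hb1 : b < 1) (hc1 : c < 1)
    (hs : P + Q + R < 2) (hdet : 0 ≤ 1 + 2 * a * b * c - a ^ 2 - b ^ 2 - c ^ 2) :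
    1 + 2 * a * b * c - a ^ 2 - b ^ 2 - c ^ 2 <
      (1 - P) * (1 - a ^ 2) + (1 - Q) * (1 - b ^ 2) + (1 - R) * (1 - c ^ 2) := by
  obtain ⟨d, hd⟩ : ∃ d, d = 1 + 2 * a * b * c - a ^ 2 - b ^ 2 - c ^ 2 := ⟨_, rfl⟩
  rw [← hd] at hdet ⊢
  have hda : d ≤ 1 - a ^ 2 := by
    linarith [sq_nonneg (b - a * c), mul_nonneg (sub_nonneg.2 ha) (sq_nonneg c)]
  have hdb : d ≤ 1 - b ^ 2 := by
    linarith [sq_nonneg (a - b * c), mul_nonneg (sub_nonneg.2 hb) (sq_nonneg c)]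
  have hdc : d ≤ 1 - c ^ 2 := by
    linarith [sq_nonneg (a - b * c), mul_nonneg (sub_nonneg.2 hc) (sq_nonneg b)]
  rcases hdet.eq_or_lt with h0 | h0
  · have h1 := mul_nonneg hP.le (sub_nonneg.2 ha)
    have h2 := mul_nonneg hQ.le (sub_nonneg.2 hb)
    have h3 := mul_nonneg hR.le (sub_nonneg.2 hc)
    by_contra! hcon
    have hzero {t g : ℝ} (ht : 0 < t) (hg : g < 1) (h : t * (1 - g ^ 2) = 0) : g = -1 := by
      have h' := (mul_eq_zero.1 h).resolve_left ht.ne'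
      have : (1 - g) * (1 + g) = 0 := by linarith
      linarith [(mul_eq_zero.1 this).resolve_left (by linarith)]
    have ea := hzero hP ha1 (by linarith)
    have eb := hzero hQ hb1 (by linarith)
    have ec := hzero hR hc1 (by linarith)
    rw [← h0, ea, eb, ec] at hd
    norm_num at hd
  · have h1 := mul_le_mul_of_nonneg_left hda hP.le
    have h2 := mul_le_mul_of_nonneg_left hdb hQ.le
    have h3 := mul_le_mul_of_nonneg_left hdc hR.le
    linarith [mul_pos h0 (by linarith : 0 < 2 - P - Q - R)]

/-- If the radii are sorted and their squares sum to at least `2`, the Gram determinant of three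
unit vectors with pairwise inner products `a`, `b`, `c` is smaller than the weighted sum of its
principal minors. -/
theorem gram_det_lt_of_sorted {p q r a b c : ℝ} (hr : 0 < r) (hrq : r ≤ q) (hqp : q ≤ p)
    (hp : p < 1) (ha : a ^ 2 ≤ 1) (hb : b ^ 2 ≤ 1) (hc : c ^ 2 ≤ 1)
    (hqra : (q + r) ^ 2 ≤ 2 - 2 * a) (hprb : (p + r) ^ 2 ≤ 2 - 2 * b)
    (hpqc : (p + q) ^ 2 ≤ 2 - 2 * c) (hs : 2 ≤ p ^ 2 + q ^ 2 + r ^ 2) :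
    1 + 2 * a * b * c - a ^ 2 - b ^ 2 - c ^ 2 <
      (1 - p ^ 2) * (1 - a ^ 2) + (1 - q ^ 2) * (1 - b ^ 2) + (1 - r ^ 2) * (1 - c ^ 2) := by
  have hq : q < 1 := by linarith
  have hP : 0 < 1 - p ^ 2 := by nlinarith
  obtain ⟨ha1, ha2⟩ := abs_le.1 ((sq_le_one_iff_abs_le_one a).1 ha)
  obtain ⟨hb1, hb2⟩ := abs_le.1 ((sq_le_one_iff_abs_le_one b).1 hb)
  obtain ⟨hc1, hc2⟩ := abs_le.1 ((sq_le_one_iff_abs_le_one c).1 hc)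
  suffices h : 0 < (2 - p ^ 2 - q ^ 2) - r ^ 2 * ((1 + c) * (2 - (1 + c)))
      + p ^ 2 * a ^ 2 + q ^ 2 * b ^ 2 + 2 * (1 - (1 + c)) * (a * b) by linarith
  have hRQ : r ^ 2 ≤ q ^ 2 := pow_le_pow_left₀ hr.le hrq 2
  have hQP : q ^ 2 ≤ p ^ 2 := pow_le_pow_left₀ (hr.le.trans hrq) hqp 2
  have hq2 : 1 / 2 < q ^ 2 := by linarith
  have hqh : 1 / 2 < q := by
    by_contra! hcon
    linarith [pow_le_pow_left₀ (hr.le.trans hrq) hcon 2]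
  have hpq : q ^ 2 ≤ p * q := by
    rw [sq]
    gcongr
  have hr2 : 0 < r ^ 2 := by positivity
  obtain ⟨T, hT⟩ : ∃ T, T = 2 - p ^ 2 - q ^ 2 := ⟨_, rfl⟩
  obtain ⟨δ, hδ⟩ : ∃ δ, δ = p - q := ⟨_, rfl⟩
  obtain ⟨e, he⟩ : ∃ e, e = 1 + c := ⟨_, rfl⟩
  obtain ⟨f, hf⟩ : ∃ f, f = T + δ ^ 2 / 2 := ⟨_, rfl⟩
  have hf' : f = 2 - (p + q) ^ 2 / 2 := by rw [hf, hT, hδ]; ring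
  have hδ0 : 0 ≤ δ := by linarith
  have hTδ : 3 / 2 * δ < T := by
    linarith [mul_nonneg (sub_nonneg.2 hq.le) (sub_nonneg.2 hqh.le)]
  have hTT : T ≤ 2 / 3 := by linarith
  have hef : e ≤ f := by linarith
  have he0 : 0 ≤ e := by linarith
  have hTf : T ≤ f := by linarith [sq_nonneg δ]
  have hf1 : f ≤ 5 / 6 := by linarith
  have hpq1 : 2 * (1 - p * q) = T + δ ^ 2 := by rw [hT, hδ]; ring
  have hδδ : δ ^ 2 ≤ T / 2 := by
    linarith [mul_nonneg hδ0 (by linarith : 0 ≤ 4 / 9 - δ)]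
  have hδf : 2 * δ ^ 2 ≤ f ^ 2 := by
    linarith [pow_le_pow_left₀ (by positivity) (by linarith : 3 / 2 * δ ≤ f) 2, sq_nonneg δ]
  rw [← he, ← hT]
  have hmono : e * (2 - e) ≤ f * (2 - f) := by
    linarith [mul_nonneg (sub_nonneg.2 hef) (by linarith : 0 ≤ 2 - f - e)]
  have he2 : 0 ≤ e * (2 - e) := mul_nonneg he0 (by linarith)
  have hf0 : 0 < f := by linarith
  have hhalf (h : r ^ 2 ≤ 1 / 2) : r ^ 2 * (e * (2 - e)) < T := by
    linarith [mul_le_mul h hmono he2 (by norm_num), pow_pos hf0 2]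
  have hrr : (2 * r) ^ 2 ≤ (q + r) ^ 2 := pow_le_pow_left₀ (by positivity) (by linarith) 2
  have hpr : (q + r) ^ 2 ≤ (p + r) ^ 2 := pow_le_pow_left₀ (by linarith) (by linarith) 2
  rcases lt_or_ge (a * b) 0 with hab | hab
  · have hor := mul_neg_iff.1 hab
    have hrh : r ^ 2 ≤ 1 / 2 := by
      rcases hor with h | h <;> linarith
    have hm : -(a * b) ≤ 1 / 2 := by
      have h1 : 1 ≤ (q + r) ^ 2 := by linarith [mul_pos (hr.trans_le hrq) hr]
      rcases hor with h | h
      · linarith [mul_nonneg h.1.le (by linarith : 0 ≤ b + 1)]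
      · linarith [mul_nonneg h.2.le (by linarith : 0 ≤ a + 1)]
    have hlin := hhalf hrh
    have hsq : 2 * (p * q) * (-(a * b)) ≤ p ^ 2 * a ^ 2 + q ^ 2 * b ^ 2 := by
      linarith [sq_nonneg (p * a + q * b)]
    obtain ⟨m, hm'⟩ : ∃ m, m = -(a * b) := ⟨_, rfl⟩
    rw [← hm'] at hm hsq
    have hend : 0 < T - r ^ 2 * (e * (2 - e)) - (T + δ ^ 2) * (1 / 2) + e := by
      linarith [mul_le_mul_of_nonneg_right hrh he2, sq_nonneg e]
    have hm0 : 0 < m := by linarith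
    rw [show a * b = -m by linarith]
    linarith [mul_pos hm0 hend, mul_nonneg (sub_nonneg.2 hm) (sub_nonneg.2 hlin.le),
      congrArg (m * ·) hpq1]
  · rcases le_or_gt (r ^ 2) (1 / 2) with hrh | hrh
    · have h1 := hhalf hrh
      have h2 : 0 ≤ p ^ 2 * a ^ 2 + q ^ 2 * b ^ 2 := by positivity
      have h3 : 0 ≤ (1 - e) * (a * b) := mul_nonneg (by linarith) hab
      linarith
    · obtain ⟨k, hk⟩ : ∃ k, k = 2 * r ^ 2 - 1 := ⟨_, rfl⟩
      have hk0 : 0 < k := by linarith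
      have hak : k ≤ -a := by linarith
      have hbk : k ≤ -b := by linarith
      have h1 : k ^ 2 ≤ a ^ 2 := by simpa using pow_le_pow_left₀ hk0.le hak 2
      have h2 : k ^ 2 ≤ b ^ 2 := by simpa using pow_le_pow_left₀ hk0.le hbk 2
      have h3 : k ^ 2 ≤ a * b := by
        linarith [mul_le_mul hak hbk hk0.le (hk0.le.trans hak)]
      have h4 : p ^ 2 * k ^ 2 ≤ p ^ 2 * a ^ 2 := by gcongr
      have h5 : q ^ 2 * k ^ 2 ≤ q ^ 2 * b ^ 2 := by gcongr
      have h6 : (1 - e) * k ^ 2 ≤ (1 - e) * (a * b) :=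
        mul_le_mul_of_nonneg_left h3 (by linarith)
      have h7 : r ^ 2 * (e * (2 - e)) ≤ r ^ 2 * (f * (2 - f)) := by gcongr
      have h8 : (1 - f) * k ^ 2 ≤ (1 - e) * k ^ 2 := by gcongr
      have h9 : r ^ 2 = (1 + k) / 2 := by linarith
      have h10 : p ^ 2 * k ^ 2 + q ^ 2 * k ^ 2 = (2 - T) * k ^ 2 := by rw [hT]; ring
      rw [h9] at h7 ⊢
      have h11 : 0 < f ^ 2 / 4 - k * f + k ^ 2 * (3 / 2) := by
        linarith [sq_nonneg (f / 2 - k), pow_pos hk0 2]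
      have h12 : k ^ 2 * (3 / 2) ≤ k ^ 2 * (4 - T - 2 * f) := by
        gcongr
        linarith
      linarith [mul_nonneg hk0.le (sq_nonneg f)]

/-- Three unit vectors with pairwise inner products `a`, `b`, `c` that are the centers of
non-overlapping balls of radii `p`, `q`, `r` less than `1` have a Gram determinant smaller than the
weighted sum of its principal minors. -/
theorem gram_det_lt {p q r a b c : ℝ} (hp0 : 0 < p) (hq0 : 0 < q) (hr0 : 0 < r)
    (hp : p < 1) (hq : q < 1) (hr : r < 1) (ha : a ^ 2 ≤ 1) (hb : b ^ 2 ≤ 1) (hc : c ^ 2 ≤ 1)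
    (hqra : (q + r) ^ 2 ≤ 2 - 2 * a) (hprb : (p + r) ^ 2 ≤ 2 - 2 * b)
    (hpqc : (p + q) ^ 2 ≤ 2 - 2 * c) (hdet : 0 ≤ 1 + 2 * a * b * c - a ^ 2 - b ^ 2 - c ^ 2) :
    1 + 2 * a * b * c - a ^ 2 - b ^ 2 - c ^ 2 <
      (1 - p ^ 2) * (1 - a ^ 2) + (1 - q ^ 2) * (1 - b ^ 2) + (1 - r ^ 2) * (1 - c ^ 2) := by
  have hrqa : (r + q) ^ 2 ≤ 2 - 2 * a := by rwa [add_comm r q]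
  have hrpb : (r + p) ^ 2 ≤ 2 - 2 * b := by rwa [add_comm r p]
  have hqpc : (q + p) ^ 2 ≤ 2 - 2 * c := by rwa [add_comm q p]
  rcases lt_or_ge (p ^ 2 + q ^ 2 + r ^ 2) 2 with hs | hs
  · exact gram_det_lt_of_sum_lt (by nlinarith) (by nlinarith) (by nlinarith) ha hb hc
      (by nlinarith) (by nlinarith) (by nlinarith) hs hdet
  rcases le_total p q with h1 | h1 <;> rcases le_total q r with h2 | h2 <;>
    rcases le_total p r with h3 | h3
  · linarith [gram_det_lt_of_sorted hp0 h1 h2 hr hc hb ha hqpc hrpb hrqa (by linarith)]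
  · linarith [gram_det_lt_of_sorted hp0 h1 h2 hr hc hb ha hqpc hrpb hrqa (by linarith)]
  · linarith [gram_det_lt_of_sorted hp0 h3 h2 hq hb hc ha hrpb hqpc hqra (by linarith)]
  · linarith [gram_det_lt_of_sorted hr0 h3 h1 hq hb ha hc hprb hqra hqpc (by linarith)]
  · linarith [gram_det_lt_of_sorted hq0 h1 h3 hr hc ha hb hpqc hrqa hrpb (by linarith)]
  · linarith [gram_det_lt_of_sorted hq0 h2 h3 hp ha hc hb hrqa hpqc hprb (by linarith)]
  · linarith [gram_det_lt_of_sorted hr0 h2 h1 hp ha hb hc hqra hprb hpqc (by linarith)]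
  · linarith [gram_det_lt_of_sorted hr0 h2 h1 hp ha hb hc hqra hprb hpqc (by linarith)]

/-- The Gram determinant of three unit vectors is the square of their triple product. -/
theorem triple_product_sq {x y z : Fin 3 → ℝ} (hx : x ⬝ᵥ x = 1) (hy : y ⬝ᵥ y = 1)
    (hz : z ⬝ᵥ z = 1) :
    (x ⬝ᵥ (y ⨯₃ z)) ^ 2 = 1 + 2 * (y ⬝ᵥ z) * (x ⬝ᵥ z) * (x ⬝ᵥ y) - (y ⬝ᵥ z) ^ 2
      - (x ⬝ᵥ z) ^ 2 - (x ⬝ᵥ y) ^ 2 := by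
  have : (x ⬝ᵥ (y ⨯₃ z)) ^ 2 = (x ⬝ᵥ x) * (y ⬝ᵥ y) * (z ⬝ᵥ z)
      + 2 * (y ⬝ᵥ z) * (x ⬝ᵥ z) * (x ⬝ᵥ y) - (x ⬝ᵥ x) * (y ⬝ᵥ z) ^ 2
      - (y ⬝ᵥ y) * (x ⬝ᵥ z) ^ 2 - (z ⬝ᵥ z) * (x ⬝ᵥ y) ^ 2 := by
    simp only [cross_apply, dotProduct, Fin.sum_univ_three, Matrix.cons_val]
    ring
  rw [this, hx, hy, hz]
  ring

/-- Three unit vectors whose Gram determinant is smaller than a weighted sum of its principal minors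
admit a common vector making a large angle with each of them. -/
theorem exists_dotProduct_sq_lt {x y z : Fin 3 → ℝ} {S : Fin 3 → ℝ} (hS : ∀ i, 0 < S i)
    (hx : x ⬝ᵥ x = 1) (hy : y ⬝ᵥ y = 1) (hz : z ⬝ᵥ z = 1)
    (h : 1 + 2 * (y ⬝ᵥ z) * (x ⬝ᵥ z) * (x ⬝ᵥ y) - (y ⬝ᵥ z) ^ 2 - (x ⬝ᵥ z) ^ 2 - (x ⬝ᵥ y) ^ 2 <
      S 0 * (1 - (y ⬝ᵥ z) ^ 2) + S 1 * (1 - (x ⬝ᵥ z) ^ 2) + S 2 * (1 - (x ⬝ᵥ y) ^ 2)) :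
    ∃ u : Fin 3 → ℝ, (x ⬝ᵥ u) ^ 2 < S 0 * (u ⬝ᵥ u) ∧ (y ⬝ᵥ u) ^ 2 < S 1 * (u ⬝ᵥ u) ∧
      (z ⬝ᵥ u) ^ 2 < S 2 * (u ⬝ᵥ u) := by
  obtain ⟨D, hD⟩ : ∃ D, D = x ⬝ᵥ (y ⨯₃ z) := ⟨_, rfl⟩
  have hDy : y ⬝ᵥ (z ⨯₃ x) = D := (triple_product_permutation x y z).symm.trans hD.symm
  have hDz : z ⬝ᵥ (x ⨯₃ y) = D := (triple_product_permutation y z x).symm.trans hDy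
  have hDD := triple_product_sq hx hy hz
  rw [← hD] at hDD
  rw [← hDD] at h
  obtain ⟨s, hs⟩ : ∃ s : Fin 3 → ℝ, ∀ i, s i ^ 2 = S i :=
    ⟨fun i => √(S i), fun i => Real.sq_sqrt (hS i).le⟩
  let u (σ τ : ℝ) : Fin 3 → ℝ :=
    s 0 • (y ⨯₃ z) + (σ * s 1) • (z ⨯₃ x) + (τ * s 2) • (x ⨯₃ y)
  have hxu (σ τ : ℝ) : x ⬝ᵥ u σ τ = s 0 * D := by
    simp [u, dotProduct_add, dotProduct_smul, hD]
  have hyu (σ τ : ℝ) : y ⬝ᵥ u σ τ = σ * s 1 * D := by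
    simp [u, dotProduct_add, dotProduct_smul, hDy]
  have hzu (σ τ : ℝ) : z ⬝ᵥ u σ τ = τ * s 2 * D := by
    simp [u, dotProduct_add, dotProduct_smul, hDz]
  suffices hN : ∃ σ τ : ℝ, σ ^ 2 = 1 ∧ τ ^ 2 = 1 ∧ D ^ 2 < u σ τ ⬝ᵥ u σ τ by
    obtain ⟨σ, τ, hσ, hτ, hN⟩ := hN
    refine ⟨u σ τ, ?_, ?_, ?_⟩
    · rw [hxu, mul_pow, hs]
      exact mul_lt_mul_of_pos_left hN (hS 0)
    · rw [hyu, mul_pow, mul_pow, hs, hσ, one_mul]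
      exact mul_lt_mul_of_pos_left hN (hS 1)
    · rw [hzu, mul_pow, mul_pow, hs, hτ, one_mul]
      exact mul_lt_mul_of_pos_left hN (hS 2)
  have hsum : u 1 1 ⬝ᵥ u 1 1 + u 1 (-1) ⬝ᵥ u 1 (-1) + u (-1) 1 ⬝ᵥ u (-1) 1
      + u (-1) (-1) ⬝ᵥ u (-1) (-1) = 4 * (S 0 * (1 - (y ⬝ᵥ z) ^ 2) + S 1 * (1 - (x ⬝ᵥ z) ^ 2)
        + S 2 * (1 - (x ⬝ᵥ y) ^ 2)) := by
    have hyz : (y ⨯₃ z) ⬝ᵥ (y ⨯₃ z) = 1 - (y ⬝ᵥ z) ^ 2 := by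
      rw [cross_dot_cross, hy, hz, dotProduct_comm z y]; ring
    have hzx : (z ⨯₃ x) ⬝ᵥ (z ⨯₃ x) = 1 - (x ⬝ᵥ z) ^ 2 := by
      rw [cross_dot_cross, hx, hz, dotProduct_comm z x]; ring
    have hxy : (x ⨯₃ y) ⬝ᵥ (x ⨯₃ y) = 1 - (x ⬝ᵥ y) ^ 2 := by
      rw [cross_dot_cross, hx, hy, dotProduct_comm y x]; ring
    rw [← hyz, ← hzx, ← hxy, ← hs 0, ← hs 1, ← hs 2]
    simp only [u, dotProduct_add, add_dotProduct, dotProduct_smul, smul_dotProduct, smul_eq_mul]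
    ring
  by_contra! hcon
  linarith [hcon 1 1 (by norm_num) (by norm_num), hcon 1 (-1) (by norm_num) (by norm_num),
    hcon (-1) 1 (by norm_num) (by norm_num), hcon (-1) (-1) (by norm_num) (by norm_num)]

/-- A line `ℝ u` making a large enough angle with the unit vector `a` misses a closed ball
centered at `a`. -/
theorem smul_notMem_closedBall_of_inner_sq_lt {E : Type*} [NormedAddCommGroup E]
    [InnerProductSpace ℝ E] {a u : E} {r : ℝ} (ha : ‖a‖ = 1)
    (h : ⟪a, u⟫ ^ 2 < (1 - r ^ 2) * ‖u‖ ^ 2) (t : ℝ) : t • u ∉ closedBall a r := by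
  rw [mem_closedBall, dist_eq_norm, not_le]
  refine lt_of_pow_lt_pow_left₀ 2 (norm_nonneg _) ?_
  rw [norm_sub_sq_real, norm_smul, mul_pow, Real.norm_eq_abs, sq_abs, real_inner_smul_left,
    real_inner_comm, ha]
  have hu : 0 < ‖u‖ ^ 2 := by nlinarith [sq_nonneg ⟪a, u⟫]
  nlinarith [sq_nonneg (t * ‖u‖ ^ 2 - ⟪a, u⟫)]
theorem three_closed_balls_no_shadow_at_sphere_center
    (a : Fin 3 → EuclideanSpace ℝ (Fin 3)) (r : Fin 3 → ℝ)
    (ha : ∀ i, ‖a i‖ = 1) (hr : ∀ i, 0 < r i)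
    (hsep : ∀ i j, i ≠ j → r i + r j ≤ dist (a i) (a j))
    (h0 : ∀ i, (0 : EuclideanSpace ℝ (Fin 3)) ∉ Metric.closedBall (a i) (r i)) :
    ∃ v : EuclideanSpace ℝ (Fin 3), v ≠ 0 ∧
      ∀ (t : ℝ) (i : Fin 3), t • v ∉ Metric.closedBall (a i) (r i) := by
  have hr1 (i) : r i < 1 := by
    simpa [ha i] using h0 i
  have hinner (i j) : ⟪a i, a j⟫ = (a i).ofLp ⬝ᵥ (a j).ofLp := by
    rw [EuclideanSpace.inner_eq_star_dotProduct, dotProduct_comm]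
    simp
  have hself (i) : (a i).ofLp ⬝ᵥ (a i).ofLp = 1 := by
    rw [← hinner, real_inner_self_eq_norm_sq, ha, one_pow]
  have hsq (i j) : ((a i).ofLp ⬝ᵥ (a j).ofLp) ^ 2 ≤ 1 := by
    rw [← hinner, sq_le_one_iff_abs_le_one]
    simpa [ha] using abs_real_inner_le_norm (a i) (a j)
  have hdist (i j) (hij : i ≠ j) :
      (r i + r j) ^ 2 ≤ 2 - 2 * ((a i).ofLp ⬝ᵥ (a j).ofLp) := by
    have h1 := pow_le_pow_left₀ (add_pos (hr i) (hr j)).le (hsep i j hij) 2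
    rw [dist_eq_norm, norm_sub_sq_real, ha, ha, hinner] at h1
    linarith
  obtain ⟨u, h⟩ := exists_dotProduct_sq_lt (S := fun i => 1 - r i ^ 2)
    (fun i => by nlinarith [hr i, hr1 i]) (hself 0) (hself 1) (hself 2)
    (gram_det_lt (hr 0) (hr 1) (hr 2) (hr1 0) (hr1 1) (hr1 2) (hsq 1 2) (hsq 0 2) (hsq 0 1)
      (hdist 1 2 (by decide)) (hdist 0 2 (by decide)) (hdist 0 1 (by decide))
      (by rw [← triple_product_sq (hself 0) (hself 1) (hself 2)]; positivity))
  have hu (i) : ⟪a i, WithLp.toLp 2 u⟫ ^ 2 < (1 - r i ^ 2) * ‖WithLp.toLp 2 u‖ ^ 2 := by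
    rw [← real_inner_self_eq_norm_sq, EuclideanSpace.inner_eq_star_dotProduct,
      EuclideanSpace.inner_eq_star_dotProduct, dotProduct_comm]
    simp only [star_trivial]
    fin_cases i
    exacts [h.1, h.2.1, h.2.2]
  refine ⟨WithLp.toLp 2 u, ?_, fun t i => smul_notMem_closedBall_of_inner_sq_lt (ha i) (hu i) t⟩
  intro h
  simpa [h] using hu 0
end

section
/- Let B_1, B_2, B_3 be three open balls in Euclidean 3-space with centers a_1, a_2, a_3 on the unit sphere (‖a_i‖ = 1) and radii r_1, r_2, r_3 > 0, which are pairwise non-overlapping (dist(a_i, a_j) ≥ r_i + r_j for i ≠ j) and none of which contains the origin (0 ∉ B_i). Then there exists a nonzero vector v ∈ ℝ³ such that the line {t • v : t ∈ ℝ} through the origin intersects none of the three balls. -/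
open Metric RealInnerProductSpace

/-- The shadow inequality when one squared radius is at most `1` and the other two are bounded
by the squares of the half-chords they are constrained by. -/
lemma weighted_chord_sum_le_of_le_sq {X Y Z A B C : ℝ} (hX0 : 0 ≤ X) (hX1 : X ≤ 1)
    (hY0 : 0 ≤ Y) (hY1 : Y ≤ 1) (hZ0 : 0 ≤ Z) (hZ1 : Z ≤ 1)
    (hA : A ≤ 1) (hB : B ≤ Z ^ 2) (hC : C ≤ Y ^ 2) :
    A * (X * (1 - X)) + B * (Y * (1 - Y)) + C * (Z * (1 - Z)) ≤
      X + Y + Z - 2 * (X * Y + Y * Z + Z * X) + 4 * (X * Y * Z) := by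
  have h1 := mul_le_mul_of_nonneg_right hA (mul_nonneg hX0 (sub_nonneg.2 hX1))
  have h2 := mul_le_mul_of_nonneg_right hB (mul_nonneg hY0 (sub_nonneg.2 hY1))
  have h3 := mul_le_mul_of_nonneg_right hC (mul_nonneg hZ0 (sub_nonneg.2 hZ1))
  have hS : 0 ≤ Y * (1 - Z) + Z * (1 - Y) :=
    add_nonneg (mul_nonneg hY0 (sub_nonneg.2 hZ1)) (mul_nonneg hZ0 (sub_nonneg.2 hY1))
  have h4 := mul_nonneg hS (mul_nonneg (sub_nonneg.2 hY1) (sub_nonneg.2 hZ1))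
  have h5 := sq_nonneg (X - (Y * (1 - Z) + Z * (1 - Y)))
  linarith

/-- The shadow inequality on `[A₀, 1]` follows from its extremal case at the left endpoint,
by concavity. -/
lemma weighted_chord_sum_le_of_endpoint {X Y Z A B C A₀ : ℝ} (hX0 : 0 ≤ X) (hX1 : X ≤ 1)
    (hY0 : 0 ≤ Y) (hY1 : Y ≤ 1) (hZ0 : 0 ≤ Z) (hZ1 : Z ≤ 1)
    (hA0 : 0 < A) (hA1 : A ≤ 1) (hAB : A * B ≤ Z ^ 2) (hCA : C * A ≤ Y ^ 2)
    (hA : A₀ ≤ A)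
    (hend : A₀ ^ 2 * (X * (1 - X)) + Z ^ 2 * (Y * (1 - Y)) + Y ^ 2 * (Z * (1 - Z)) ≤
      A₀ * (X + Y + Z - 2 * (X * Y + Y * Z + Z * X) + 4 * (X * Y * Z))) :
    A * (X * (1 - X)) + B * (Y * (1 - Y)) + C * (Z * (1 - Z)) ≤
      X + Y + Z - 2 * (X * Y + Y * Z + Z * X) + 4 * (X * Y * Z) := by
  rcases hA1.eq_or_lt with rfl | hlt
  · exact weighted_chord_sum_le_of_le_sq hX0 hX1 hY0 hY1 hZ0 hZ1 le_rfl (by linarith)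
      (by linarith)
  have hone := weighted_chord_sum_le_of_le_sq hX0 hX1 hY0 hY1 hZ0 hZ1 le_rfl
    (le_refl (Z ^ 2)) (le_refl (Y ^ 2))
  have h2 := mul_le_mul_of_nonneg_right hAB (mul_nonneg hY0 (sub_nonneg.2 hY1))
  have h3 := mul_le_mul_of_nonneg_right hCA (mul_nonneg hZ0 (sub_nonneg.2 hZ1))
  have hP := mul_nonneg hX0 (sub_nonneg.2 hX1)
  have h01 : 0 < 1 - A₀ := by linarith
  generalize X + Y + Z - 2 * (X * Y + Y * Z + Z * X) + 4 * (X * Y * Z) = K at *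
  generalize X * (1 - X) = P at *
  generalize Y * (1 - Y) = Q at *
  generalize Z * (1 - Z) = R at *
  have key : 0 ≤ (1 - A₀) * (A * K - A ^ 2 * P - Z ^ 2 * Q - Y ^ 2 * R) := by
    have e1 := mul_nonneg (sub_nonneg.2 hlt.le) (sub_nonneg.2 hend)
    have e2 := mul_nonneg (sub_nonneg.2 hA) (sub_nonneg.2 hone)
    have e3 := mul_nonneg (mul_nonneg (mul_nonneg hP (sub_nonneg.2 hlt.le)) (sub_nonneg.2 hA))
      h01.le
    linarith
  have key' := nonneg_of_mul_nonneg_right key h01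
  refine le_of_mul_le_mul_left ?_ hA0
  linarith

lemma weighted_chord_sum_le_of_mul_le_of_le {X Y Z A B C : ℝ} (hX0 : 0 < X) (hX1 : X ≤ 1)
    (hY0 : 0 < Y) (hY1 : Y ≤ 1) (hZ0 : 0 < Z) (hZ1 : Z ≤ 1)
    (hA0 : 0 < A) (hA1 : A ≤ 1) (hB1 : B ≤ 1)
    (hAB : A * B ≤ Z ^ 2) (hCA : C * A ≤ Y ^ 2) (h : Y ≤ X * Z) (hAX : Y * Z ≤ A * X) :
    A * (X * (1 - X)) + B * (Y * (1 - Y)) + C * (Z * (1 - Z)) ≤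
      X + Y + Z - 2 * (X * Y + Y * Z + Z * X) + 4 * (X * Y * Z) := by
  have hYZ : (Y / Z) ^ 2 ≤ X ^ 2 := by
    have : Y / Z ≤ X := (div_le_iff₀ hZ0).2 h
    gcongr
  rcases le_total (Z ^ 2) A with hZA | hZA
  · refine weighted_chord_sum_le_of_endpoint hX0.le hX1 hY0.le hY1 hZ0.le hZ1 hA0 hA1 hAB hCA
      hZA ?_
    have hv := weighted_chord_sum_le_of_le_sq hY0.le hY1 hZ0.le hZ1 hX0.le hX1 (le_refl 1)
      hYZ (le_refl (Z ^ 2))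
    have e := mul_le_mul_of_nonneg_left hv (sq_nonneg Z)
    have hd : Z ^ 2 * (Y / Z) ^ 2 = Y ^ 2 := by field_simp
    linear_combination e - (Z * (1 - Z)) * hd
  · have hC : C ≤ X ^ 2 := by
      refine le_of_mul_le_mul_right ?_ hA0
      have h1 : Y * Y ≤ Y * (X * Z) := mul_le_mul_of_nonneg_left h hY0.le
      have h2 : X * (Y * Z) ≤ X * (A * X) := mul_le_mul_of_nonneg_left hAX hX0.le
      linarith
    have := weighted_chord_sum_le_of_le_sq hY0.le hY1 hZ0.le hZ1 hX0.le hX1 hB1 hC hZA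
    linarith

lemma weighted_chord_sum_le_of_le {X Y Z A B C : ℝ} (hX0 : 0 < X) (hX1 : X ≤ 1)
    (hY0 : 0 < Y) (hY1 : Y ≤ 1) (hZ0 : 0 < Z) (hZ1 : Z ≤ 1)
    (hA0 : 0 < A) (hA1 : A ≤ 1) (hB1 : B ≤ 1) (hC0 : 0 < C) (hC1 : C ≤ 1)
    (hAB : A * B ≤ Z ^ 2) (hBC : B * C ≤ X ^ 2) (hCA : C * A ≤ Y ^ 2) (h : Y ≤ X * Z) :
    A * (X * (1 - X)) + B * (Y * (1 - Y)) + C * (Z * (1 - Z)) ≤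
      X + Y + Z - 2 * (X * Y + Y * Z + Z * X) + 4 * (X * Y * Z) := by
  rcases le_total (Y * Z) (A * X) with hA | hA
  · exact weighted_chord_sum_le_of_mul_le_of_le hX0 hX1 hY0 hY1 hZ0 hZ1 hA0 hA1 hB1 hAB hCA h hA
  rcases le_total (Y * X) (C * Z) with hC | hC
  · have := weighted_chord_sum_le_of_mul_le_of_le (B := B) (C := A) hZ0 hZ1 hY0 hY1 hX0 hX1
      hC0 hC1 hB1 (by linarith) (by linarith) (by linarith) hC
    linarith
  have hA' : A ≤ Z ^ 2 := by
    refine le_of_mul_le_mul_right ?_ hX0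
    have := mul_le_mul_of_nonneg_right h hZ0.le
    linarith
  have hC' : C ≤ X ^ 2 := by
    refine le_of_mul_le_mul_right ?_ hZ0
    have := mul_le_mul_of_nonneg_right h hX0.le
    linarith
  have := weighted_chord_sum_le_of_le_sq hY0.le hY1 hZ0.le hZ1 hX0.le hX1 hB1 hC' hA'
  linarith

lemma quartic_nonneg_of_one_le {p q s : ℝ} (hp : 1 ≤ p) (hpq : p ≤ q) (hps : p ≤ s) :
    0 ≤ p * q * s * (p + q + s) - 3 * (p * q + q * s + s * p) + 7 := by
  have h1 : 0 ≤ (q - p) * (s - p) := mul_nonneg (by linarith) (by linarith)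
  have h2 : 0 ≤ p ^ 2 + p * (q + s) - 3 := by nlinarith
  have h3 := mul_nonneg h1 h2
  have h4 : 0 ≤ (p * (q + s) - 3) ^ 2 - (p ^ 2 - 1) * (p ^ 2 - 2) := by
    rcases le_total (p ^ 2) 2 with hp2 | hp2
    · nlinarith [sq_nonneg (p * (q + s) - 3),
        mul_nonneg (show 0 ≤ p ^ 2 - 1 by nlinarith) (sub_nonneg.2 hp2)]
    · have h5 : 2 * p ^ 2 - 3 ≤ p * (q + s) - 3 := by nlinarith
      have h6 : (2 * p ^ 2 - 3) ^ 2 ≤ (p * (q + s) - 3) ^ 2 :=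
        pow_le_pow_left₀ (by linarith) h5 2
      nlinarith [sq_nonneg (p ^ 2 - 3 / 2)]
  linarith

lemma extremal_chord_nonneg {X Y Z : ℝ} (hX0 : 0 < X) (hY0 : 0 < Y) (hZ0 : 0 < Z)
    (hX : Y * Z ≤ X) (hY : Z * X ≤ Y) (hZ : X * Y ≤ Z) :
    0 ≤ X + Y + Z - 3 * (X * Y + Y * Z + Z * X) + 7 * (X * Y * Z) := by
  obtain ⟨t, ht, ht2⟩ : ∃ t : ℝ, 0 < t ∧ t ^ 2 = X * Y * Z :=
    ⟨√(X * Y * Z), by positivity, Real.sq_sqrt (by positivity)⟩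
  have one_le_div {W : ℝ} (hW0 : 0 < W) (hW : X * Y * Z ≤ W * W) : 1 ≤ W / t := by
    rw [one_le_div ht]
    exact (pow_le_pow_iff_left₀ ht.le hW0.le two_ne_zero).1 (by linarith)
  have hp := one_le_div hX0 (by nlinarith)
  have hq := one_le_div hY0 (by nlinarith)
  have hs := one_le_div hZ0 (by nlinarith)
  have hXp : X / t * t = X := div_mul_cancel₀ _ ht.ne'
  have hYq : Y / t * t = Y := div_mul_cancel₀ _ ht.ne'
  have hZs : Z / t * t = Z := div_mul_cancel₀ _ ht.ne'
  generalize X / t = p at *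
  generalize Y / t = q at *
  generalize Z / t = s at *
  subst hXp hYq hZs
  have hone : p * q * s * t = 1 := by
    refine mul_left_cancel₀ (pow_ne_zero 2 ht.ne') ?_
    linarith
  have hquart : 0 ≤ p * q * s * (p + q + s) - 3 * (p * q + q * s + s * p) + 7 := by
    rcases le_total p q with h1 | h1
    · rcases le_total p s with h2 | h2
      · exact quartic_nonneg_of_one_le hp h1 h2
      · linarith [quartic_nonneg_of_one_le hs h2 (h2.trans h1)]
    · rcases le_total q s with h2 | h2
      · linarith [quartic_nonneg_of_one_le hq h1 h2]
      · linarith [quartic_nonneg_of_one_le hs h2 (h2.trans h1)]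
  have hm := mul_nonneg (sq_nonneg t) hquart
  linear_combination hm + (t * (p + q + s) - 7 * t ^ 2) * hone

lemma weighted_chord_sum_le_of_mul_le {X Y Z A B C : ℝ} (hX0 : 0 < X) (hX1 : X ≤ 1)
    (hY0 : 0 < Y) (hY1 : Y ≤ 1) (hZ0 : 0 < Z) (hZ1 : Z ≤ 1)
    (hA0 : 0 < A) (hA1 : A ≤ 1) (hAB : A * B ≤ Z ^ 2) (hCA : C * A ≤ Y ^ 2)
    (hAX : Y * Z ≤ A * X)
    (hg : 0 ≤ X + Y + Z - 3 * (X * Y + Y * Z + Z * X) + 7 * (X * Y * Z)) :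
    A * (X * (1 - X)) + B * (Y * (1 - Y)) + C * (Z * (1 - Z)) ≤
      X + Y + Z - 2 * (X * Y + Y * Z + Z * X) + 4 * (X * Y * Z) := by
  refine weighted_chord_sum_le_of_endpoint hX0.le hX1 hY0.le hY1 hZ0.le hZ1 hA0 hA1 hAB hCA
    ((div_le_iff₀ hX0).2 hAX) ?_
  have hm := mul_nonneg (div_nonneg (mul_nonneg hY0.le hZ0.le) hX0.le) hg
  have hd : Y * Z / X * X = Y * Z := div_mul_cancel₀ _ hX0.ne'
  generalize Y * Z / X = D at *
  linear_combination hm + (D * (1 - X) - (Y + Z - 2 * Y * Z)) * hd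

/-- The shadow inequality for squared radii `A`, `B`, `C` and squared half-chords `X`, `Y`, `Z`. -/
lemma weighted_chord_sum_le {X Y Z A B C : ℝ} (hX0 : 0 < X) (hX1 : X ≤ 1)
    (hY0 : 0 < Y) (hY1 : Y ≤ 1) (hZ0 : 0 < Z) (hZ1 : Z ≤ 1)
    (hA0 : 0 < A) (hA1 : A ≤ 1) (hB0 : 0 < B) (hB1 : B ≤ 1) (hC0 : 0 < C) (hC1 : C ≤ 1)
    (hAB : A * B ≤ Z ^ 2) (hBC : B * C ≤ X ^ 2) (hCA : C * A ≤ Y ^ 2) :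
    A * (X * (1 - X)) + B * (Y * (1 - Y)) + C * (Z * (1 - Z)) ≤
      X + Y + Z - 2 * (X * Y + Y * Z + Z * X) + 4 * (X * Y * Z) := by
  rcases le_total Y (X * Z) with hY | hY
  · exact weighted_chord_sum_le_of_le hX0 hX1 hY0 hY1 hZ0 hZ1 hA0 hA1 hB1 hC0 hC1 hAB hBC hCA hY
  rcases le_total Z (Y * X) with hZ | hZ
  · have := weighted_chord_sum_le_of_le hY0 hY1 hZ0 hZ1 hX0 hX1 hB0 hB1 hC1 hA0 hA1 hBC hCA hAB hZ
    linarith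
  rcases le_total X (Z * Y) with hX | hX
  · have := weighted_chord_sum_le_of_le hZ0 hZ1 hX0 hX1 hY0 hY1 hC0 hC1 hA1 hB0 hB1 hCA hAB hBC hX
    linarith
  have hg := extremal_chord_nonneg hX0 hY0 hZ0 (by linarith) (by linarith) (by linarith)
  rcases le_total (Y * Z) (A * X) with hA | hA
  · exact weighted_chord_sum_le_of_mul_le hX0 hX1 hY0 hY1 hZ0 hZ1 hA0 hA1 hAB hCA hA hg
  rcases le_total (Z * X) (B * Y) with hB | hB
  · have := weighted_chord_sum_le_of_mul_le hY0 hY1 hZ0 hZ1 hX0 hX1 hB0 hB1 hBC hAB hB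
      (by linarith)
    linarith
  rcases le_total (X * Y) (C * Z) with hC | hC
  · have := weighted_chord_sum_le_of_mul_le hZ0 hZ1 hX0 hX1 hY0 hY1 hC0 hC1 hCA hBC hC
      (by linarith)
    linarith
  have e1 := mul_le_mul_of_nonneg_right hA (sub_nonneg.2 hX1)
  have e2 := mul_le_mul_of_nonneg_right hB (sub_nonneg.2 hY1)
  have e3 := mul_le_mul_of_nonneg_right hC (sub_nonneg.2 hZ1)
  linarith

lemma exists_sign_norm_sq_add_le {E : Type*} [NormedAddCommGroup E] [InnerProductSpace ℝ E]
    (p q : E) : ∃ ε : ℝ, ε ^ 2 = 1 ∧ ‖p‖ ^ 2 + ‖q‖ ^ 2 ≤ ‖p + ε • q‖ ^ 2 := by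
  rcases le_total 0 ⟪p, q⟫ with h | h
  · refine ⟨1, by norm_num, ?_⟩
    rw [one_smul, norm_add_sq_real]
    linarith
  · refine ⟨-1, by norm_num, ?_⟩
    rw [neg_one_smul, ← sub_eq_add_neg, norm_sub_sq_real]
    linarith

/-- A line whose direction makes a large enough angle with the unit vector `a` misses the
ball of radius `r` around `a`. -/
lemma smul_notMem_ball_of_inner_sq_le {E : Type*} [NormedAddCommGroup E] [InnerProductSpace ℝ E]
    {a v : E} {r : ℝ} (ha : ‖a‖ = 1) (hv : v ≠ 0)
    (h : ⟪a, v⟫ ^ 2 ≤ (1 - r ^ 2) * ‖v‖ ^ 2) (t : ℝ) : t • v ∉ ball a r := by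
  intro hmem
  rw [mem_ball, dist_eq_norm] at hmem
  have hsq : ‖t • v - a‖ ^ 2 < r ^ 2 := by gcongr
  rw [norm_sub_sq_real, ha, norm_smul, mul_pow, Real.norm_eq_abs, sq_abs, real_inner_smul_left,
    real_inner_comm] at hsq
  have hN : 0 < ‖v‖ ^ 2 := by positivity
  have := mul_lt_mul_of_pos_right hsq hN
  linarith [sq_nonneg (t * ‖v‖ ^ 2 - ⟪a, v⟫)]

/-- The cross product on Euclidean space. -/
def euclideanCross (a b : EuclideanSpace ℝ (Fin 3)) : EuclideanSpace ℝ (Fin 3) :=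
  !₂[a 1 * b 2 - a 2 * b 1, a 2 * b 0 - a 0 * b 2, a 0 * b 1 - a 1 * b 0]

lemma inner_eq_sum_three (a b : EuclideanSpace ℝ (Fin 3)) :
    ⟪a, b⟫ = a 0 * b 0 + a 1 * b 1 + a 2 * b 2 := by
  simp [PiLp.inner_apply, Fin.sum_univ_three, mul_comm]

lemma norm_euclideanCross_sq (a b : EuclideanSpace ℝ (Fin 3)) :
    ‖euclideanCross a b‖ ^ 2 = ‖a‖ ^ 2 * ‖b‖ ^ 2 - ⟪a, b⟫ ^ 2 := by
  simp only [← real_inner_self_eq_norm_sq, inner_eq_sum_three]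
  simp [euclideanCross]
  ring

lemma inner_self_euclideanCross (a b : EuclideanSpace ℝ (Fin 3)) :
    ⟪a, euclideanCross a b⟫ = 0 := by
  simp [inner_eq_sum_three, euclideanCross]
  ring

lemma inner_euclideanCross_self (a b : EuclideanSpace ℝ (Fin 3)) :
    ⟪b, euclideanCross a b⟫ = 0 := by
  simp [inner_eq_sum_three, euclideanCross]
  ring

lemma inner_euclideanCross_rotate (a b c : EuclideanSpace ℝ (Fin 3)) :
    ⟪b, euclideanCross c a⟫ = ⟪a, euclideanCross b c⟫ := by
  simp [inner_eq_sum_three, euclideanCross]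
  ring

lemma inner_euclideanCross_sq (a b c : EuclideanSpace ℝ (Fin 3)) :
    ⟪a, euclideanCross b c⟫ ^ 2 =
      ‖a‖ ^ 2 * ‖b‖ ^ 2 * ‖c‖ ^ 2 + 2 * (⟪a, b⟫ * ⟪b, c⟫ * ⟪c, a⟫) - ‖a‖ ^ 2 * ⟪b, c⟫ ^ 2 -
        ‖b‖ ^ 2 * ⟪c, a⟫ ^ 2 - ‖c‖ ^ 2 * ⟪a, b⟫ ^ 2 := by
  simp only [← real_inner_self_eq_norm_sq, inner_eq_sum_three]
  simp [euclideanCross]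
  ring

lemma exists_ne_zero_inner_eq_zero_of_triple_eq_zero {a b c : EuclideanSpace ℝ (Fin 3)}
    (h : ⟪a, euclideanCross b c⟫ = 0) : ∃ v ≠ 0, ⟪a, v⟫ = 0 ∧ ⟪b, v⟫ = 0 ∧ ⟪c, v⟫ = 0 := by
  have hdet : (Matrix.of ![a.ofLp, b.ofLp, c.ofLp]).det = 0 := by
    rw [← h, Matrix.det_fin_three, inner_eq_sum_three]
    simp [euclideanCross]
    ring
  obtain ⟨v, hv, hz⟩ := Matrix.exists_mulVec_eq_zero_iff.2 hdet
  refine ⟨WithLp.toLp 2 v, by simpa using hv, ?_, ?_, ?_⟩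
  · simpa [inner_eq_sum_three, Matrix.mulVec, dotProduct, Fin.sum_univ_three]
      using congrFun hz 0
  · simpa [inner_eq_sum_three, Matrix.mulVec, dotProduct, Fin.sum_univ_three]
      using congrFun hz 1
  · simpa [inner_eq_sum_three, Matrix.mulVec, dotProduct, Fin.sum_univ_three]
      using congrFun hz 2

/-- A direction with prescribed bounds on its inner products with three vectors exists as soon
as an averaged Gram inequality holds. -/
lemma exists_ne_zero_inner_sq_le {a b c : EuclideanSpace ℝ (Fin 3)} {A B C : ℝ}
    (hA : 0 ≤ A) (hB : 0 ≤ B) (hC : 0 ≤ C)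
    (h : ⟪a, euclideanCross b c⟫ ^ 2 ≤ A * ‖euclideanCross b c‖ ^ 2 +
      B * ‖euclideanCross c a‖ ^ 2 + C * ‖euclideanCross a b‖ ^ 2) :
    ∃ v ≠ 0, ⟪a, v⟫ ^ 2 ≤ A * ‖v‖ ^ 2 ∧ ⟪b, v⟫ ^ 2 ≤ B * ‖v‖ ^ 2 ∧ ⟪c, v⟫ ^ 2 ≤ C * ‖v‖ ^ 2 := by
  by_cases hD : ⟪a, euclideanCross b c⟫ = 0
  · obtain ⟨v, hv, h1, h2, h3⟩ := exists_ne_zero_inner_eq_zero_of_triple_eq_zero hD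
    refine ⟨v, hv, ?_, ?_, ?_⟩
    · simpa [h1] using mul_nonneg hA (sq_nonneg ‖v‖)
    · simpa [h2] using mul_nonneg hB (sq_nonneg ‖v‖)
    · simpa [h3] using mul_nonneg hC (sq_nonneg ‖v‖)
  obtain ⟨ε, hε, h1⟩ := exists_sign_norm_sq_add_le (√A • euclideanCross b c)
    (√B • euclideanCross c a)
  obtain ⟨δ, hδ, h2⟩ := exists_sign_norm_sq_add_le
    (√A • euclideanCross b c + ε • √B • euclideanCross c a) (√C • euclideanCross a b)
  set v := √A • euclideanCross b c + ε • √B • euclideanCross c a + δ • √C • euclideanCross a b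
    with hv
  simp only [norm_smul, mul_pow, Real.norm_eq_abs, sq_abs, Real.sq_sqrt, hA, hB, hC] at h1 h2
  have hDv : ⟪a, euclideanCross b c⟫ ^ 2 ≤ ‖v‖ ^ 2 := by linarith
  have hb : ⟪b, euclideanCross c a⟫ = ⟪a, euclideanCross b c⟫ := inner_euclideanCross_rotate a b c
  have hc : ⟪c, euclideanCross a b⟫ = ⟪a, euclideanCross b c⟫ :=
    (inner_euclideanCross_rotate b c a).trans hb
  refine ⟨v, ?_, ?_, ?_, ?_⟩
  · intro h0
    rw [h0, norm_zero] at hDv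
    have := pow_pos (abs_pos.2 hD) 2
    rw [sq_abs] at this
    linarith
  all_goals
    simp only [hv, inner_add_right, inner_smul_right, inner_self_euclideanCross,
      inner_euclideanCross_self, hb, hc, mul_zero, add_zero, zero_add, mul_pow, Real.sq_sqrt,
      hA, hB, hC, hε, hδ, one_mul]
    rw [← hv]
    gcongr

/-- Three pairwise non-overlapping open balls with centers on the unit sphere,
none containing the origin, do not generate the shadow at the center. -/
theorem three_open_balls_no_shadow_at_sphere_center
    (a : Fin 3 → EuclideanSpace ℝ (Fin 3)) (r : Fin 3 → ℝ)
    (ha : ∀ i, ‖a i‖ = 1) (hr : ∀ i, 0 < r i)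
    (hsep : ∀ i j, i ≠ j → r i + r j ≤ dist (a i) (a j))
    (h0 : ∀ i, (0 : EuclideanSpace ℝ (Fin 3)) ∉ Metric.ball (a i) (r i)) :
    ∃ v : EuclideanSpace ℝ (Fin 3), v ≠ 0 ∧
      ∀ (t : ℝ) (i : Fin 3), t • v ∉ Metric.ball (a i) (r i) := by
  have hr1 : ∀ i, r i ≤ 1 := fun i => by
    simpa [ha i] using h0 i
  have hsq1 : ∀ i, r i ^ 2 ≤ 1 := fun i => pow_le_one₀ (hr i).le (hr1 i)
  have hchord : ∀ i j, i ≠ j → r i * r j ≤ (1 - ⟪a i, a j⟫) / 2 := fun i j hij => by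
    have hs := hsep i j hij
    have hs2 : (r i + r j) ^ 2 ≤ dist (a i) (a j) ^ 2 := by
      have := hr i; have := hr j; gcongr
    rw [dist_eq_norm, norm_sub_sq_real, ha, ha] at hs2
    linarith [sq_nonneg (r i - r j)]
  have hpos : ∀ i j, 0 < r i * r j := fun i j => mul_pos (hr i) (hr j)
  have hle1 : ∀ i j, (1 - ⟪a i, a j⟫) / 2 ≤ 1 := fun i j => by
    have := neg_le_of_abs_le (abs_real_inner_le_norm (a i) (a j))
    rw [ha, ha] at this
    linarith
  have hprod : ∀ i j, i ≠ j → r i ^ 2 * r j ^ 2 ≤ ((1 - ⟪a i, a j⟫) / 2) ^ 2 := fun i j hij => by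
    rw [← mul_pow]
    have := hpos i j
    have := hchord i j hij
    gcongr
  have key := weighted_chord_sum_le ((hpos 1 2).trans_le (hchord 1 2 (by decide))) (hle1 1 2)
    ((hpos 2 0).trans_le (hchord 2 0 (by decide))) (hle1 2 0)
    ((hpos 0 1).trans_le (hchord 0 1 (by decide))) (hle1 0 1)
    (pow_pos (hr 0) 2) (hsq1 0) (pow_pos (hr 1) 2) (hsq1 1) (pow_pos (hr 2) 2) (hsq1 2)
    (hprod 0 1 (by decide)) (hprod 1 2 (by decide)) (hprod 2 0 (by decide))
  obtain ⟨v, hv, hv0, hv1, hv2⟩ := exists_ne_zero_inner_sq_le (a := a 0) (b := a 1) (c := a 2)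
    (sub_nonneg.2 (hsq1 0)) (sub_nonneg.2 (hsq1 1)) (sub_nonneg.2 (hsq1 2)) (by
      simp only [inner_euclideanCross_sq, norm_euclideanCross_sq, ha]
      linarith)
  refine ⟨v, hv, fun t i => smul_notMem_ball_of_inner_sq_le (ha i) hv ?_ t⟩
  fin_cases i
  · exact hv0
  · exact hv1
  · exact hv2
end

section
/- For every real number d with 1 < d ≤ 2√2, any three closed balls in Euclidean 3-space with centers on the prolate ellipsoid E_d = {p : (p 0)²/d² + (p 1)² + (p 2)² = 1}, pairwise non-overlapping (distance between centers at least the sum of radii) and none containing the origin, fail to generate the shadow at the origin: there exists a nonzero vector v such that the line {t • v : t ∈ ℝ} intersects none of the three balls. (Thus the minimal ratio 2√2 between the ellipsoid's major and minor axes is not attained.) -/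
theorem nonneg_or_sq_le_of_copositive {a b c : ℝ} (ha : 0 ≤ a)
    (h : ∀ x y : ℝ, 0 ≤ x → 0 ≤ y → 0 ≤ a * x ^ 2 + b * y ^ 2 + c * (x * y)) :
    0 ≤ c ∨ c ^ 2 ≤ 4 * a * b := by
  by_contra! hc
  obtain ⟨hc, hab⟩ := hc
  rcases ha.eq_or_lt with rfl | ha
  · have hb : 0 ≤ b := by simpa using h 0 1 le_rfl zero_le_one
    have := h ((b + 1) / -c) 1 (div_nonneg (by linarith) (by linarith)) zero_le_one
    have e : c * ((b + 1) / -c * 1) = -(b + 1) := by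
      have := hc.ne
      field_simp
    rw [e] at this
    linarith
  · have := h (-c) (2 * a) (by linarith) (by linarith)
    have := mul_pos ha (sub_pos.2 hab)
    nlinarith

theorem sq_mul_add_sq_mul_le {p q M N : ℝ} (hp : 0 < p) (hq : 0 < q) (hM : 0 < M) (hN : 0 < N)
    (h : ∀ x y : ℝ, 0 ≤ x → 0 ≤ y → (p * x + q * y) ^ 2 ≤ x ^ 2 * M + y ^ 2 * N) :
    p ^ 2 * N + q ^ 2 * M ≤ M * N := by
  have h1 := h (p * N) (q * M) (by positivity) (by positivity)
  have h2 : 0 < p ^ 2 * N + q ^ 2 * M := by positivity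
  refine le_of_mul_le_mul_left ?_ h2
  nlinarith

section
variable {t₁ s t₃ r₁ l r₃ A B C : ℝ}

theorem two_mul_add_le_of_block
    (hs : 0 ≤ s) (hp : s ≤ t₁) (hq : s ≤ t₃)
    (hB : ∀ x y z : ℝ, (|x| * t₁ + |y| * s + |z| * t₃) ^ 2 ≤
      x ^ 2 * (r₁ ^ 2 + t₁ ^ 2) + y ^ 2 * (l ^ 2 + s ^ 2) + z ^ 2 * (r₃ ^ 2 + t₃ ^ 2) +
        2 * (x * y * A + x * z * B + y * z * C))
    (hA : 2 * A ≤ t₁ ^ 2 + s ^ 2 - 2 * r₁ * l) (hC : 2 * C ≤ s ^ 2 + t₃ ^ 2 - 2 * l * r₃)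
    {x z u w : ℝ} (hx : 0 ≤ x) (hz : 0 ≤ z) (hu : 0 ≤ u) (hw : 0 ≤ w) :
    ((t₁ - s) * x + (t₃ - s) * z) ^ 2 ≤
      x * (x + u) * (t₁ - s) ^ 2 + (x * r₁ - u * l) ^ 2 +
        (z * (z + w) * (t₃ - s) ^ 2 + (z * r₃ - w * l) ^ 2) := by
  have h1 := hB x (u + w) z
  have h2 := hB x (u - w) (-z)
  rw [abs_of_nonneg hx, abs_of_nonneg hz, abs_of_nonneg (add_nonneg hu hw)] at h1
  rw [abs_of_nonneg hx, abs_neg, abs_of_nonneg hz] at h2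
  obtain ⟨p, rfl⟩ : ∃ p, t₁ = p + s := ⟨t₁ - s, by ring⟩
  obtain ⟨q, rfl⟩ : ∃ q, t₃ = q + s := ⟨t₃ - s, by ring⟩
  have hp : 0 ≤ p := by linarith
  have hq : 0 ≤ q := by linarith
  have h3 := mul_le_mul_of_nonneg_left hA (mul_nonneg hx hu)
  have h4 := mul_le_mul_of_nonneg_left hC (mul_nonneg hz hw)
  have n1 : 0 ≤ s * (p * x) := by positivity
  have n2 : 0 ≤ s * (q * z) := by positivity
  have n3 := mul_nonneg (sq_nonneg s) (mul_nonneg hx hz)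
  have n4 := mul_nonneg n1 hz
  have n5 := mul_nonneg n2 hx
  rcases le_total u w with huw | huw
  · rw [abs_of_nonpos (by linarith)] at h2
    have n6 := mul_nonneg n1 (sub_nonneg.2 huw)
    have n7 := mul_nonneg (sq_nonneg s) (mul_nonneg hx (sub_nonneg.2 huw))
    linarith
  · rw [abs_of_nonneg (by linarith)] at h2
    have n6 := mul_nonneg n2 (sub_nonneg.2 huw)
    have n7 := mul_nonneg (sq_nonneg s) (mul_nonneg hz (sub_nonneg.2 huw))
    linarith

theorem block_diff
    (hB : ∀ x y z : ℝ, (|x| * t₁ + |y| * s + |z| * t₃) ^ 2 ≤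
      x ^ 2 * (r₁ ^ 2 + t₁ ^ 2) + y ^ 2 * (l ^ 2 + s ^ 2) + z ^ 2 * (r₃ ^ 2 + t₃ ^ 2) +
        2 * (x * y * A + x * z * B + y * z * C))
    (hA : 2 * A ≤ t₁ ^ 2 + s ^ 2 - 2 * r₁ * l) (hBB : 2 * B ≤ t₁ ^ 2 + t₃ ^ 2 - 2 * r₁ * r₃)
    (hC : 2 * C ≤ s ^ 2 + t₃ ^ 2 - 2 * l * r₃)
    {x y z : ℝ} (hx : 0 ≤ x) (hy : 0 ≤ y) (hz : 0 ≤ z) :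
    0 ≤ x ^ 2 * r₁ ^ 2 + y ^ 2 * l ^ 2 + z ^ 2 * r₃ ^ 2 + x * y * ((t₁ - s) ^ 2 - 2 * r₁ * l) +
      x * z * ((t₁ - t₃) ^ 2 - 2 * r₁ * r₃) + y * z * ((t₃ - s) ^ 2 - 2 * l * r₃) := by
  have h1 := hB x y z
  rw [abs_of_nonneg hx, abs_of_nonneg hz, abs_of_nonneg hy] at h1
  have h3 := mul_le_mul_of_nonneg_left hA (mul_nonneg hx hy)
  have h4 := mul_le_mul_of_nonneg_left hC (mul_nonneg hy hz)
  have h5 := mul_le_mul_of_nonneg_left hBB (mul_nonneg hx hz)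
  nlinarith

theorem lt_of_block (hs : 0 < s) (ht : 0 < t₁) (hl : 0 < l) (hr : 0 < r₃) (hq : s ≤ t₃)
    (hB : ∀ x y z : ℝ, (|x| * t₁ + |y| * s + |z| * t₃) ^ 2 ≤
      x ^ 2 * (r₁ ^ 2 + t₁ ^ 2) + y ^ 2 * (l ^ 2 + s ^ 2) + z ^ 2 * (r₃ ^ 2 + t₃ ^ 2) +
        2 * (x * y * A + x * z * B + y * z * C))
    (hC : 2 * C ≤ s ^ 2 + t₃ ^ 2 - 2 * l * r₃) : s < t₃ := by
  refine lt_of_le_of_ne hq ?_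
  rintro rfl
  set K := s * (l + r₃) with hK
  have hKp : 0 < K := by positivity
  set n := (r₁ ^ 2 + 1) / (2 * t₁ * K) with hn
  have hn0 : 0 < n := by positivity
  have e : n * (2 * t₁ * K) = r₁ ^ 2 + 1 := by rw [hn]; field_simp
  have h1 := hB 1 (n * r₃) (n * l)
  have h2 := hB (-1) (n * r₃) (n * l)
  rw [abs_neg] at h2
  rw [abs_one, abs_of_nonneg (by positivity), abs_of_nonneg (by positivity : 0 ≤ n * l)] at h1 h2
  have h4 := mul_le_mul_of_nonneg_left hC (by positivity : 0 ≤ n ^ 2 * (l * r₃))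
  rw [hK] at e
  nlinarith

end

section
variable {p q r₁ l r₃ : ℝ}

theorem two_mul_le_of_sq_le (hp : 0 < p) (hq : 0 < q) (hqp : q ≤ p) (hl : 0 < l)
    (h₁ : p ^ 2 ≤ 2 * l * r₁) (h₃ : q ^ 2 ≤ 2 * l * r₃)
    (hII : ∀ x z u w : ℝ, 0 ≤ x → 0 ≤ z → 0 ≤ u → 0 ≤ w → (p * x + q * z) ^ 2 ≤
      x * (x + u) * p ^ 2 + (x * r₁ - u * l) ^ 2 + (z * (z + w) * q ^ 2 + (z * r₃ - w * l) ^ 2))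
    (hE : ∀ x y z : ℝ, 0 ≤ x → 0 ≤ y → 0 ≤ z → 0 ≤ x ^ 2 * r₁ ^ 2 + y ^ 2 * l ^ 2 +
      z ^ 2 * r₃ ^ 2 + x * y * (p ^ 2 - 2 * r₁ * l) + x * z * ((p - q) ^ 2 - 2 * r₁ * r₃) +
      y * z * (q ^ 2 - 2 * l * r₃)) :
    2 * l ≤ p := by
  obtain ⟨y₁, hy₁⟩ : ∃ y, p ^ 2 = 2 * l * y := ⟨p ^ 2 / (2 * l), by field_simp⟩
  obtain ⟨y₃, hy₃⟩ : ∃ y, q ^ 2 = 2 * l * y := ⟨q ^ 2 / (2 * l), by field_simp⟩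
  have l2 : 0 < 2 * l := by positivity
  have y1p : 0 < y₁ := pos_of_mul_pos_right (hy₁ ▸ by positivity) l2.le
  have y3p : 0 < y₃ := pos_of_mul_pos_right (hy₃ ▸ by positivity) l2.le
  rw [hy₁] at h₁
  rw [hy₃] at h₃
  have h₁ := le_of_mul_le_mul_left h₁ l2
  have h₃ := le_of_mul_le_mul_left h₃ l2
  obtain ⟨x₁, rfl⟩ : ∃ x, r₁ = (x + y₁) / 2 := ⟨2 * r₁ - y₁, by ring⟩
  obtain ⟨x₃, rfl⟩ : ∃ x, r₃ = (x + y₃) / 2 := ⟨2 * r₃ - y₃, by ring⟩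
  have x1p : 0 < x₁ := by linarith
  have x3p : 0 < x₃ := by linarith
  have hX : 4 * l ^ 2 ≤ x₁ * x₃ := by
    have := sq_mul_add_sq_mul_le hp hq (M := y₁ * (2 * l + x₁)) (N := y₃ * (2 * l + x₃))
      (by positivity) (by positivity) fun x z hx hz => by
        have e₁ : x * ((x₁ - y₁) / 2) / l * l = x * ((x₁ - y₁) / 2) := by field_simp
        have e₃ : z * ((x₃ - y₃) / 2) / l * l = z * ((x₃ - y₃) / 2) := by field_simp
        have := hII x z (x * ((x₁ - y₁) / 2) / l) (z * ((x₃ - y₃) / 2) / l) hx hz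
          (div_nonneg (mul_nonneg hx (by linarith)) hl.le)
          (div_nonneg (mul_nonneg hz (by linarith)) hl.le)
        set u := x * ((x₁ - y₁) / 2) / l
        set w := z * ((x₃ - y₃) / 2) / l
        rw [e₁, e₃, hy₁, hy₃] at this
        linear_combination this + 2 * x * y₁ * e₁ + 2 * z * y₃ * e₃
    rw [hy₁, hy₃] at this
    have h2 : 0 < y₁ * y₃ := by positivity
    refine le_of_mul_le_mul_left ?_ h2
    linarith
  have hc := nonneg_or_sq_le_of_copositive (a := x₁ * y₁) (b := x₃ * y₃)
    (c := (p - q) ^ 2 - x₁ * x₃ - y₁ * y₃) (by positivity) fun x z hx hz => by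
      have e : (x * (x₁ - y₁) + z * (x₃ - y₃)) / (2 * l) * l =
        (x * (x₁ - y₁) + z * (x₃ - y₃)) / 2 := by field_simp
      have := hE x ((x * (x₁ - y₁) + z * (x₃ - y₃)) / (2 * l)) z hx (div_nonneg
        (add_nonneg (mul_nonneg hx (by linarith)) (mul_nonneg hz (by linarith))) l2.le) hz
      set y := (x * (x₁ - y₁) + z * (x₃ - y₃)) / (2 * l)
      rw [hy₁, hy₃] at this
      have e2 : (y * l) ^ 2 = ((x * (x₁ - y₁) + z * (x₃ - y₃)) / 2) ^ 2 := by rw [e]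
      linear_combination this + e2 - (x * (x₁ - y₁) + z * (x₃ - y₃)) * e
  obtain ⟨Y, hY⟩ : ∃ Y, p * q = 2 * l * Y := ⟨p * q / (2 * l), by field_simp⟩
  have Yp : 0 < Y := pos_of_mul_pos_right (hY ▸ by positivity) l2.le
  have hYY : y₁ * y₃ = Y ^ 2 := by
    have : (2 * l) ^ 2 * (y₁ * y₃) = (2 * l) ^ 2 * Y ^ 2 := by
      linear_combination (p * q + 2 * l * Y) * hY - q ^ 2 * hy₁ - 2 * l * y₁ * hy₃
    exact mul_left_cancel₀ (by positivity) this
  obtain ⟨X, Xp, hXX⟩ : ∃ X, 0 < X ∧ x₁ * x₃ = X ^ 2 :=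
    ⟨√(x₁ * x₃), by positivity, (Real.sq_sqrt (by positivity)).symm⟩
  have hX2 : 2 * l ≤ X := by
    rw [hXX] at hX
    exact le_of_sq_le_sq (by linarith) Xp.le
  have key : (X - Y) ^ 2 ≤ (p - q) ^ 2 := by
    rw [hXX, hYY] at hc
    rcases hc with hc | hc
    · nlinarith [mul_pos Xp Yp]
    · have e : 4 * (x₁ * y₁) * (x₃ * y₃) = (2 * (X * Y)) ^ 2 := by
        linear_combination 4 * y₁ * y₃ * hXX + 4 * X ^ 2 * hYY
      rw [e] at hc
      have := (abs_le_of_sq_le_sq' hc (by positivity)).1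
      linarith
  rcases le_total (2 * l) Y with h | h
  · nlinarith
  · have := abs_le_of_sq_le_sq key (by linarith)
    have := le_of_sq_le_sq key (by linarith)
    have : 0 ≤ (p - 2 * l) * (q + 2 * l) := by nlinarith
    linarith [nonneg_of_mul_nonneg_left this (by positivity)]

theorem mul_sq_le_of_sq_le (hp : 0 < p) (hq : 0 < q) (hl : 0 < l) (hr₃ : 0 < r₃)
    (h₁ : p ^ 2 ≤ 2 * l * r₁)
    (hII : ∀ x z u w : ℝ, 0 ≤ x → 0 ≤ z → 0 ≤ u → 0 ≤ w → (p * x + q * z) ^ 2 ≤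
      x * (x + u) * p ^ 2 + (x * r₁ - u * l) ^ 2 + (z * (z + w) * q ^ 2 + (z * r₃ - w * l) ^ 2)) :
    (2 * l * q) ^ 2 ≤ (4 * l * r₁ - p ^ 2) * r₃ ^ 2 := by
  obtain ⟨y₁, hy₁⟩ : ∃ y, p ^ 2 = 2 * l * y := ⟨p ^ 2 / (2 * l), by field_simp⟩
  have l2 : 0 < 2 * l := by positivity
  have y1p : 0 < y₁ := pos_of_mul_pos_right (hy₁ ▸ by positivity) l2.le
  rw [hy₁] at h₁
  have h₁ := le_of_mul_le_mul_left h₁ l2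
  obtain ⟨x₁, rfl⟩ : ∃ x, r₁ = (x + y₁) / 2 := ⟨2 * r₁ - y₁, by ring⟩
  have x1p : 0 < x₁ := by linarith
  have := sq_mul_add_sq_mul_le hp hq (M := y₁ * (2 * l + x₁)) (N := q ^ 2 + r₃ ^ 2)
    (by positivity) (by positivity) fun x z hx hz => by
      have e₁ : x * ((x₁ - y₁) / 2) / l * l = x * ((x₁ - y₁) / 2) := by field_simp
      have := hII x z (x * ((x₁ - y₁) / 2) / l) 0 hx hz
        (div_nonneg (mul_nonneg hx (by linarith)) hl.le) le_rfl
      set u := x * ((x₁ - y₁) / 2) / l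
      rw [e₁, hy₁] at this
      linear_combination this + 2 * x * y₁ * e₁
  rw [hy₁] at this
  have : 2 * l * q ^ 2 ≤ x₁ * r₃ ^ 2 := by
    refine le_of_mul_le_mul_left ?_ y1p
    linarith
  have := mul_le_mul_of_nonneg_left this l2.le
  linear_combination this + r₃ ^ 2 * hy₁

theorem pow_three_lt_of_lt (hp : 0 < p) (hq : 0 < q) (hl : 0 < l) (hr₁ : 0 < r₁) (hr₃ : 0 < r₃)
    (h₁ : 2 * l * r₁ < p ^ 2)
    (hII : ∀ x z u w : ℝ, 0 ≤ x → 0 ≤ z → 0 ≤ u → 0 ≤ w → (p * x + q * z) ^ 2 ≤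
      x * (x + u) * p ^ 2 + (x * r₁ - u * l) ^ 2 + (z * (z + w) * q ^ 2 + (z * r₃ - w * l) ^ 2)) :
    4 * l ^ 3 < p ^ 2 * r₃ := by
  have l2 : 0 < 2 * l := by positivity
  suffices 2 * l ^ 2 < r₁ * r₃ by
    have := mul_lt_mul_of_pos_left this l2
    have := mul_lt_mul_of_pos_right h₁ hr₃
    linarith
  rcases le_or_gt (q ^ 2) (2 * l * r₃) with h₃ | h₃
  · have := mul_sq_le_of_sq_le hq hp hl hr₁ h₃ fun x z u w hx hz hu hw => by
      have := hII z x w u hz hx hw hu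
      linarith
    have h2 : 8 * l ^ 3 * r₁ < 4 * l * r₃ * r₁ ^ 2 := by
      have := mul_lt_mul_of_pos_left h₁ (by positivity : 0 < 4 * l ^ 2)
      have : 0 ≤ q ^ 2 * r₁ ^ 2 := by positivity
      linarith
    have h3 : 0 < 4 * l * r₁ := by positivity
    refine lt_of_mul_lt_mul_left ?_ h3.le
    linarith
  · have := sq_mul_add_sq_mul_le hp hq (M := p ^ 2 + r₁ ^ 2) (N := q ^ 2 + r₃ ^ 2)
      (by positivity) (by positivity) fun x z hx hz => by
        have := hII x z 0 0 hx hz le_rfl le_rfl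
        linarith
    have h2 : (2 * l * r₁) * (2 * l * r₃) < p ^ 2 * q ^ 2 :=
      mul_lt_mul'' h₁ h₃ (by positivity) (by positivity)
    have h3 : 0 < r₁ * r₃ := by positivity
    have : 4 * l ^ 2 < r₁ * r₃ := by
      refine lt_of_mul_lt_mul_left ?_ h3.le
      linarith
    nlinarith

theorem two_mul_sq_lt_of_lt (hp : 0 < p) (hq : 0 < q) (hqp : q ≤ p) (hl : 0 < l) (hr₃ : 0 < r₃)
    (h₁ : p ^ 2 ≤ 2 * l * r₁) (h₃ : 2 * l * r₃ < q ^ 2)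
    (hII : ∀ x z u w : ℝ, 0 ≤ x → 0 ≤ z → 0 ≤ u → 0 ≤ w → (p * x + q * z) ^ 2 ≤
      x * (x + u) * p ^ 2 + (x * r₁ - u * l) ^ 2 + (z * (z + w) * q ^ 2 + (z * r₃ - w * l) ^ 2)) :
    4 * l ^ 2 + r₃ ^ 2 < 2 * r₁ * r₃ := by
  have := mul_sq_le_of_sq_le hp hq hl hr₃ h₁ hII
  have h2 := mul_lt_mul_of_pos_left h₃ (by positivity : 0 < 4 * l ^ 2)
  have h3 : 2 * l * r₃ < p ^ 2 := h₃.trans_le (by gcongr)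
  have h4 := mul_lt_mul_of_pos_right h3 (by positivity : 0 < r₃ ^ 2)
  have h5 : 0 < 2 * l * r₃ := by positivity
  refine lt_of_mul_lt_mul_left ?_ h5.le
  linarith

end

theorem mul_add_le_mul_of_le {c N G M k : ℝ} (hc : 0 < c) (hN : 0 < N) (hG : 0 < G) (hGM : G ≤ M)
    (h : c * (N + G) ≤ k * G) : c * (N + M) ≤ k * M := by
  have h1 : 0 < c * N := mul_pos hc hN
  have h2 : 0 < k - c := by
    refine pos_of_mul_pos_left (b := G) ?_ hG.le
    linarith
  have := mul_le_mul_of_nonneg_left hGM h2.le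
  linarith

theorem gap_le {l r σ τ C : ℝ} (hC : 2 * C ≤ σ + τ - 2 * (l * r)) (h : σ + τ ≤ 2 * (l * r)) :
    (l * r) ^ 2 - σ * τ - C ^ 2 ≤ l * r * (σ + τ) - (σ + τ) ^ 2 / 4 - σ * τ := by
  nlinarith

theorem false_of_le {l r σ τ C : ℝ} (hl : 0 < l) (hr : 0 < r) (hσ : 0 < σ) (hτ : σ ≤ τ)
    (hrl : r ≤ l) (hC : 2 * C ≤ σ + τ - 2 * (l * r)) (hG : 0 < (l * r) ^ 2 - σ * τ - C ^ 2)
    (h : (σ + 4 * l ^ 2) * (σ * r ^ 2 + τ * l ^ 2 + 2 * (σ * τ) + ((l * r) ^ 2 - σ * τ - C ^ 2)) ≤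
      8 * (l ^ 2 + σ) * ((l * r) ^ 2 - σ * τ - C ^ 2)) : False := by
  have hτ0 : 0 < τ := hσ.trans_le hτ
  have hm : l * r ≤ l ^ 2 := by nlinarith
  have hN : l * r * (σ + τ) + 2 * (σ * τ) ≤ σ * r ^ 2 + τ * l ^ 2 + 2 * (σ * τ) := by
    have : 0 ≤ (l - r) * (τ * l - σ * r) :=
      mul_nonneg (by linarith) (sub_nonneg.2 (by gcongr))
    linarith
  have hστ := mul_pos hσ hτ0
  rcases le_total (σ + τ) (2 * (l * r)) with hα | hα
  · have := mul_add_le_mul_of_le (by positivity) (by positivity) hG (gap_le hC hα) h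
    have := mul_le_mul_of_nonneg_left hN (by positivity : 0 ≤ σ + 4 * l ^ 2)
    have := mul_le_mul_of_nonneg_left hm (by positivity : 0 ≤ σ * (σ + τ))
    have := mul_nonneg (mul_nonneg hσ.le (sub_nonneg.2 hτ)) (sq_nonneg l)
    have : 0 < l ^ 2 * (σ + τ) ^ 2 := by positivity
    have : 0 < σ * (σ + τ) ^ 2 := by positivity
    have : 0 < σ * (σ * τ) := by positivity
    have : 0 < l ^ 2 * (σ * τ) := by positivity
    nlinarith
  · have hGM : (l * r) ^ 2 - σ * τ - C ^ 2 ≤ (l * r) ^ 2 - σ * τ := by nlinarith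
    have := mul_add_le_mul_of_le (by positivity) (by positivity) hG hGM h
    have := mul_le_mul_of_nonneg_left hN (by positivity : 0 ≤ σ + 4 * l ^ 2)
    have := mul_le_mul_of_nonneg_left hα (by positivity : 0 ≤ (σ + 4 * l ^ 2) * (l * r))
    have h1 : 0 < (l * r) ^ 2 - σ * τ := by nlinarith
    have h2 : l * r ≤ τ := by linarith
    have h3 : (l * r) * (l * r) ≤ l ^ 2 * τ := mul_le_mul hm h2 (by positivity) (by positivity)
    have := mul_le_mul_of_nonneg_left h3 hσ.le
    have h4 : 0 < l ^ 2 * (l * r) ^ 2 := by positivity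
    have : 0 < l ^ 2 * (σ * τ) := by positivity
    have : 0 < σ * (σ * τ) := by positivity
    nlinarith

theorem poly_pos {e s w : ℝ} (he : 0 ≤ e) (hs : 0 < s) (hw : 0 ≤ w) (h : 2 * s + w ≤ 2 + 2 * e) :
    8 * (1 + e) * (1 + s) ^ 2 *
        ((1 + e) * (s + (s + w)) - (s + (s + w)) ^ 2 / 4 - s * (s + w)) <
      (s * (1 + e) + 4) * ((1 + e) ^ 2 + (s + w)) *
        (s * (1 + e) ^ 2 + (s + w) + 2 * (s * (s + w)) +
          ((1 + e) * (s + (s + w)) - (s + (s + w)) ^ 2 / 4 - s * (s + w))) := by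
  have h1 : 0 ≤ 2 + 2 * e - w := by linarith
  have h2 : 0 ≤ 1 + e - s := by linarith
  have a1 := mul_nonneg (by positivity : 0 ≤ w ^ 2) h1
  have a2 := mul_nonneg (by positivity : 0 ≤ s * w ^ 2) h1
  have a3 := mul_nonneg (by positivity : 0 ≤ e * s * w ^ 2) h1
  have a4 := mul_nonneg (by positivity : 0 ≤ e ^ 2 * s * w) h1
  have a5 := mul_nonneg (by positivity : 0 ≤ e * s) h2
  have a6 := mul_nonneg (by positivity : 0 ≤ e ^ 2 * s) h2
  have a7 := mul_nonneg (by positivity : 0 ≤ e ^ 2 * s ^ 2) h2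
  have a8 := mul_nonneg (by positivity : 0 ≤ e ^ 2 * s * w) h2
  have a9 := mul_nonneg (by positivity : 0 ≤ e ^ 2 * w) h1
  have b1 := mul_nonneg (by positivity : 0 ≤ e ^ 3 * s * w) h1
  have b2 := mul_nonneg (by positivity : 0 ≤ e * s * w) (sq_nonneg (e - 2))
  have c1 : 0 < s ^ 3 := by positivity
  have c : 0 ≤ w ^ 2 ∧ 0 ≤ s * w ∧ 0 ≤ s * w ^ 2 ∧ 0 ≤ s ^ 2 ∧ 0 ≤ s ^ 2 * w ∧ 0 ≤ s ^ 2 * w ^ 2 ∧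
      0 ≤ s ^ 3 * w ∧ 0 ≤ s ^ 4 ∧ 0 ≤ e * w ∧ 0 ≤ e * w ^ 2 ∧ 0 ≤ e * s ∧ 0 ≤ e * s * w ∧
      0 ≤ e * s * w ^ 2 ∧ 0 ≤ e * s ^ 2 * w ∧ 0 ≤ e * s ^ 2 * w ^ 2 ∧ 0 ≤ e * s ^ 3 := by
    refine ⟨?_, ?_, ?_, ?_, ?_, ?_, ?_, ?_, ?_, ?_, ?_, ?_, ?_, ?_, ?_, ?_⟩ <;> positivity
  have d : 0 ≤ e * s ^ 3 * w ∧ 0 ≤ e * s ^ 4 ∧ 0 ≤ e ^ 2 * w ∧ 0 ≤ e ^ 2 * s ∧ 0 ≤ e ^ 3 * w ∧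
      0 ≤ e ^ 3 * s ∧ 0 ≤ e ^ 3 * s * w ∧ 0 ≤ e ^ 3 * s ^ 2 ∧ 0 ≤ e ^ 3 * s ^ 2 * w ∧
      0 ≤ e ^ 3 * s ^ 3 ∧ 0 ≤ e ^ 4 * s ∧ 0 ≤ e ^ 4 * s * w ∧ 0 ≤ e ^ 4 * s ^ 2 ∧
      0 ≤ e ^ 5 * s ^ 2 := by
    refine ⟨?_, ?_, ?_, ?_, ?_, ?_, ?_, ?_, ?_, ?_, ?_, ?_, ?_, ?_⟩ <;> positivity
  obtain ⟨_, _, _, _, _, _, _, _, _, _, _, _, _, _, _, _⟩ := c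
  obtain ⟨_, _, _, _, _, _, _, _, _, _, _, _, _, _⟩ := d
  linarith

theorem false_of_ge_normalized {r σ τ C : ℝ} (hσ : 0 < σ) (hτ : σ ≤ τ)
    (hr : 1 ≤ r) (hC : 2 * C ≤ σ + τ - 2 * r) (hG : 0 < r ^ 2 - σ * τ - C ^ 2)
    (h : (σ * r + 4) * (r ^ 2 + τ) * (σ * r ^ 2 + τ + 2 * (σ * τ) + (r ^ 2 - σ * τ - C ^ 2)) ≤
      8 * r * (1 + σ) ^ 2 * (r ^ 2 - σ * τ - C ^ 2)) : False := by
  have hτ0 : 0 < τ := hσ.trans_le hτ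
  have hr0 : 0 < r := by linarith
  rcases le_total (σ + τ) (2 * r) with hα | hα
  · have hGM : r ^ 2 - σ * τ - C ^ 2 ≤ r * (σ + τ) - (σ + τ) ^ 2 / 4 - σ * τ := by nlinarith
    have := mul_add_le_mul_of_le (by positivity) (by positivity) hG hGM h
    have := poly_pos (e := r - 1) (s := σ) (w := τ - σ) (by linarith) hσ (by linarith)
      (by linarith)
    rw [add_sub_cancel, add_sub_cancel] at this
    linarith
  · have hGM : r ^ 2 - σ * τ - C ^ 2 ≤ r ^ 2 - σ * τ := by nlinarith
    have h1 := mul_add_le_mul_of_le (by positivity) (by positivity) hG hGM h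
    have h2 : 0 < r ^ 2 - σ * τ := by linarith
    have hv : 0 < r - σ := by nlinarith
    obtain ⟨v, rfl⟩ : ∃ v, r = σ + v := ⟨r - σ, by ring⟩
    have hv : 0 < v := by linarith
    set r := σ + v with hr
    have h3 : (σ * r + 4) * (r ^ 2 + τ) ^ 2 ≤ 8 * r * (1 + σ) * v ^ 2 := by
      have h4 : r ^ 2 - σ * τ ≤ v ^ 2 := by nlinarith
      have h5 := mul_le_mul_of_nonneg_left h4 (by positivity : 0 ≤ 8 * r * (1 + σ) ^ 2)
      have h6 : 0 < 1 + σ := by positivity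
      refine le_of_mul_le_mul_left ?_ h6
      linarith
    have h4 : r ^ 2 + r + v ≤ r ^ 2 + τ := by linarith
    have h5 : 4 * (r ^ 2 + r) * v ≤ (r ^ 2 + τ) ^ 2 := by
      have : (r ^ 2 + r + v) ^ 2 ≤ (r ^ 2 + τ) ^ 2 := by gcongr
      linarith [sq_nonneg (r ^ 2 + r - v)]
    have h6 := mul_le_mul_of_nonneg_left h5 (by positivity : 0 ≤ σ * r + 4)
    have h7 : 8 * v ^ 2 ≤ 4 * (r ^ 2 + r) * v := by
      have : 8 * v ≤ 4 * (r ^ 2 + r) := by nlinarith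
      have := mul_le_mul_of_nonneg_right this hv.le
      linarith
    have h8 : 2 * r * v ^ 2 < 4 * (r ^ 2 + r) * v := by
      have : 2 * r * v < 4 * (r ^ 2 + r) := by nlinarith
      have := mul_lt_mul_of_pos_right this hv
      linarith
    have := mul_le_mul_of_nonneg_left h7 (by positivity : 0 ≤ σ * r)
    linarith

theorem false_of_small_normalized {r σ τ r₁ C : ℝ} (hr : 0 < r) (hσ : 0 < σ)
    (hτ : σ + 2 * r ≤ τ) (hr₁ : 4 + r ^ 2 < 2 * r₁ * r) (hL : r₁ ^ 2 + τ ≤ 8 * (1 + σ))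
    (hG : 0 < r ^ 2 - σ * τ - C ^ 2)
    (h : τ * (r ^ 2 + τ) * (σ * r ^ 2 + τ + 2 * (σ * τ) + (r ^ 2 - σ * τ - C ^ 2)) ≤
      8 * (1 + σ) ^ 2 * (r ^ 2 - σ * τ - C ^ 2)) : False := by
  have hτ0 : 0 < τ := by linarith
  have hGM : r ^ 2 - σ * τ - C ^ 2 ≤ r ^ 2 - σ * τ := by nlinarith
  have h1 := mul_add_le_mul_of_le (by positivity) (by positivity) hG hGM h
  have h2 : τ * (r ^ 2 + τ) ^ 2 ≤ 8 * (1 + σ) * (r ^ 2 - σ * τ) := by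
    have h6 : 0 < 1 + σ := by positivity
    refine le_of_mul_le_mul_left ?_ h6
    linarith
  have h3 : σ * (σ + 2 * r) ≤ σ * τ := by gcongr
  rcases le_total (3 / 4) r with h4 | h4
  · have h5 : (σ + 2 * r) * (r ^ 2 + (σ + 2 * r)) ^ 2 ≤ τ * (r ^ 2 + τ) ^ 2 := by gcongr
    have h6 := mul_le_mul_of_nonneg_left h3 (by positivity : 0 ≤ 8 * (1 + σ))
    have h7 : 2 * r * (r ^ 2 + 2 * r + σ) ^ 2 ≤ 8 * (1 + σ) * r ^ 2 := by
      have : 0 ≤ σ * (r ^ 2 + (σ + 2 * r)) ^ 2 := by positivity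
      have : 0 ≤ 8 * (1 + σ) * (σ * (σ + 2 * r)) := by positivity
      linarith
    have h8 : 4 < r * (r + 2) ^ 2 := by nlinarith
    have h9 := mul_lt_mul_of_pos_left h8 (by positivity : 0 < 2 * r ^ 2)
    have : 0 < σ * r ^ 3 := by positivity
    have : 0 < σ ^ 2 * r := by positivity
    linarith
  · have h5 : σ < 0.42 * r := by nlinarith
    have h6 : (4 + r ^ 2) ^ 2 < (2 * r₁ * r) ^ 2 := by gcongr
    have h7 : r₁ ^ 2 ≤ 8 + 0.94 * r := by linarith
    have h8 := mul_le_mul_of_nonneg_right h7 (by positivity : 0 ≤ 4 * r ^ 2)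
    nlinarith [pow_pos hr 2, pow_pos hr 3]

theorem false_of_ge {l r σ τ C : ℝ} (hl : 0 < l) (hσ : 0 < σ) (hτ : σ ≤ τ) (hr : l ≤ r)
    (hC : 2 * C ≤ σ + τ - 2 * (l * r)) (hG : 0 < (l * r) ^ 2 - σ * τ - C ^ 2)
    (h : (σ * r + 4 * l ^ 3) * (r ^ 2 + τ) *
        (σ * r ^ 2 + τ * l ^ 2 + 2 * (σ * τ) + ((l * r) ^ 2 - σ * τ - C ^ 2)) ≤
      8 * r * (l ^ 2 + σ) ^ 2 * ((l * r) ^ 2 - σ * τ - C ^ 2)) : False := by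
  have hl2 : 0 < l ^ 2 := by positivity
  obtain ⟨r, rfl⟩ : ∃ x, r = l * x := ⟨r / l, by field_simp⟩
  obtain ⟨σ, rfl⟩ : ∃ x, σ = l ^ 2 * x := ⟨σ / l ^ 2, by field_simp⟩
  obtain ⟨τ, rfl⟩ : ∃ x, τ = l ^ 2 * x := ⟨τ / l ^ 2, by field_simp⟩
  obtain ⟨C, rfl⟩ : ∃ x, C = l ^ 2 * x := ⟨C / l ^ 2, by field_simp⟩
  refine false_of_ge_normalized (r := r) (σ := σ) (τ := τ) (C := C)
    (pos_of_mul_pos_right hσ hl2.le) (le_of_mul_le_mul_left hτ hl2) ?_ ?_ ?_ ?_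
  · exact le_of_mul_le_mul_left (by linarith) hl
  · exact le_of_mul_le_mul_left (by linarith) hl2
  · exact pos_of_mul_pos_right (a := l ^ 4) (by linarith) (by positivity)
  · exact le_of_mul_le_mul_left (a := l ^ 9) (by linarith) (by positivity)

theorem false_of_small {l r σ τ r₁ C : ℝ} (hl : 0 < l) (hr : 0 < r) (hσ : 0 < σ)
    (hτ : σ + 2 * (l * r) ≤ τ) (hr₁ : 4 * l ^ 2 + r ^ 2 < 2 * r₁ * r)
    (hL : r₁ ^ 2 + τ ≤ 8 * (l ^ 2 + σ)) (hG : 0 < (l * r) ^ 2 - σ * τ - C ^ 2)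
    (h : τ * (r ^ 2 + τ) *
        (σ * r ^ 2 + τ * l ^ 2 + 2 * (σ * τ) + ((l * r) ^ 2 - σ * τ - C ^ 2)) ≤
      8 * (l ^ 2 + σ) ^ 2 * ((l * r) ^ 2 - σ * τ - C ^ 2)) : False := by
  have hl2 : 0 < l ^ 2 := by positivity
  obtain ⟨r, rfl⟩ : ∃ x, r = l * x := ⟨r / l, by field_simp⟩
  obtain ⟨r₁, rfl⟩ : ∃ x, r₁ = l * x := ⟨r₁ / l, by field_simp⟩
  obtain ⟨σ, rfl⟩ : ∃ x, σ = l ^ 2 * x := ⟨σ / l ^ 2, by field_simp⟩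
  obtain ⟨τ, rfl⟩ : ∃ x, τ = l ^ 2 * x := ⟨τ / l ^ 2, by field_simp⟩
  obtain ⟨C, rfl⟩ : ∃ x, C = l ^ 2 * x := ⟨C / l ^ 2, by field_simp⟩
  refine false_of_small_normalized (r := r) (σ := σ) (τ := τ) (C := C) (r₁ := r₁)
    (pos_of_mul_pos_right hr hl.le) (pos_of_mul_pos_right hσ hl2.le) ?_ ?_ ?_ ?_ ?_
  · exact le_of_mul_le_mul_left (by linarith) hl2
  · exact lt_of_mul_lt_mul_left (a := l ^ 2) (by linarith) (by positivity)
  · exact le_of_mul_le_mul_left (by linarith) hl2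
  · exact pos_of_mul_pos_right (a := l ^ 4) (by linarith) (by positivity)
  · exact le_of_mul_le_mul_left (a := l ^ 8) (by linarith) (by positivity)

/-- Three mutually separated balls of radii `r₁, l, r₃` and tangent lengths `t₁, s, t₃` whose
Gram matrix dominates every sign pattern of the tangent lengths cannot satisfy the volume
inequality `hV`. -/
theorem false_of_block {t₁ s t₃ r₁ l r₃ A B C : ℝ} (hs : 0 < s) (hst : s ≤ t₃) (htt : t₃ ≤ t₁)
    (hr₁ : 0 < r₁) (hl : 0 < l) (hr₃ : 0 < r₃)
    (hB : ∀ x y z : ℝ, (|x| * t₁ + |y| * s + |z| * t₃) ^ 2 ≤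
      x ^ 2 * (r₁ ^ 2 + t₁ ^ 2) + y ^ 2 * (l ^ 2 + s ^ 2) + z ^ 2 * (r₃ ^ 2 + t₃ ^ 2) +
        2 * (x * y * A + x * z * B + y * z * C))
    (hA : 2 * A ≤ t₁ ^ 2 + s ^ 2 - 2 * r₁ * l) (hB' : 2 * B ≤ t₁ ^ 2 + t₃ ^ 2 - 2 * r₁ * r₃)
    (hC : 2 * C ≤ s ^ 2 + t₃ ^ 2 - 2 * l * r₃)
    (hL₁ : r₁ ^ 2 + t₁ ^ 2 ≤ 8) (hL₂ : 1 ≤ l ^ 2 + s ^ 2) (hL₃ : 1 ≤ r₃ ^ 2 + t₃ ^ 2)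
    (hS : 0 < (l ^ 2 + s ^ 2) * (r₃ ^ 2 + t₃ ^ 2) - C ^ 2)
    (hV : t₁ ^ 2 * ((l ^ 2 + s ^ 2) * (r₃ ^ 2 + t₃ ^ 2) - C ^ 2) * (r₃ ^ 2 + t₃ ^ 2) ≤
      8 * (l ^ 2 * r₃ ^ 2 - s ^ 2 * t₃ ^ 2 - C ^ 2)) : False := by
  have ht₃ : 0 < t₃ := hs.trans_le hst
  have ht₁ : 0 < t₁ := ht₃.trans_le htt
  have hlt := lt_of_block hs ht₁ hl hr₃ hst hB hC
  have hq : 0 < t₃ - s := sub_pos.2 hlt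
  have hqp : t₃ - s ≤ t₁ - s := by linarith
  have hp : 0 < t₁ - s := hq.trans_le hqp
  have hII := fun x z u w : ℝ => two_mul_add_le_of_block (x := x) (z := z) (u := u) (w := w)
    hs.le (by linarith) hst hB hA hC
  have hE : ∀ x y z : ℝ, 0 ≤ x → 0 ≤ y → 0 ≤ z → 0 ≤ x ^ 2 * r₁ ^ 2 + y ^ 2 * l ^ 2 +
      z ^ 2 * r₃ ^ 2 + x * y * ((t₁ - s) ^ 2 - 2 * r₁ * l) +
      x * z * (((t₁ - s) - (t₃ - s)) ^ 2 - 2 * r₁ * r₃) +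
      y * z * ((t₃ - s) ^ 2 - 2 * l * r₃) := fun x y z hx hy hz => by
    have := block_diff hB hA hB' hC hx hy hz
    rwa [sub_sub_sub_cancel_right]
  have hσ : 0 < s ^ 2 := by positivity
  have hστ : s ^ 2 ≤ t₃ ^ 2 := by gcongr
  have hG : 0 < (l * r₃) ^ 2 - s ^ 2 * t₃ ^ 2 - C ^ 2 := by
    have : 0 < t₁ ^ 2 * ((l ^ 2 + s ^ 2) * (r₃ ^ 2 + t₃ ^ 2) - C ^ 2) * (r₃ ^ 2 + t₃ ^ 2) := by
      positivity
    linarith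
  have hC' : 2 * C ≤ s ^ 2 + t₃ ^ 2 - 2 * (l * r₃) := by linarith
  set G := (l * r₃) ^ 2 - s ^ 2 * t₃ ^ 2 - C ^ 2 with hGdef
  have hS' : (l ^ 2 + s ^ 2) * (r₃ ^ 2 + t₃ ^ 2) - C ^ 2 =
    s ^ 2 * r₃ ^ 2 + t₃ ^ 2 * l ^ 2 + 2 * (s ^ 2 * t₃ ^ 2) + G := by rw [hGdef]; ring
  have hG' : l ^ 2 * r₃ ^ 2 - s ^ 2 * t₃ ^ 2 - C ^ 2 = G := by rw [hGdef]; ring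
  rw [hS', hG'] at hV
  rw [hS'] at hS
  set S := s ^ 2 * r₃ ^ 2 + t₃ ^ 2 * l ^ 2 + 2 * (s ^ 2 * t₃ ^ 2) + G with hSdef
  have ht₁p : s ^ 2 + (t₁ - s) ^ 2 ≤ t₁ ^ 2 := by nlinarith
  have ht₃q : s ^ 2 + (t₃ - s) ^ 2 ≤ t₃ ^ 2 := by nlinarith
  have hL₂₂ : 1 ≤ (l ^ 2 + s ^ 2) ^ 2 := one_le_pow₀ hL₂
  suffices hT : (r₃ ≤ l → s ^ 2 + 4 * l ^ 2 ≤ t₁ ^ 2) ∧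
      (l ≤ r₃ → s ^ 2 * r₃ + 4 * l ^ 3 ≤ t₁ ^ 2 * r₃) by
    rcases le_total r₃ l with h | h
    · refine false_of_le hl hr₃ hσ hστ h hC' hG ?_
      calc (s ^ 2 + 4 * l ^ 2) * S ≤ t₁ ^ 2 * S := by gcongr; exact hT.1 h
        _ ≤ t₁ ^ 2 * S * (r₃ ^ 2 + t₃ ^ 2) := le_mul_of_one_le_right (by positivity) hL₃
        _ ≤ 8 * 1 * G := by linarith
        _ ≤ 8 * (l ^ 2 + s ^ 2) * G := by gcongr
    · refine false_of_ge hl hσ hστ h hC' hG ?_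
      calc (s ^ 2 * r₃ + 4 * l ^ 3) * (r₃ ^ 2 + t₃ ^ 2) * S
          ≤ (t₁ ^ 2 * r₃) * (r₃ ^ 2 + t₃ ^ 2) * S := by gcongr; exact hT.2 h
        _ = r₃ * (t₁ ^ 2 * S * (r₃ ^ 2 + t₃ ^ 2)) := by ring
        _ ≤ r₃ * (8 * G) := by gcongr
        _ = 8 * r₃ * 1 * G := by ring
        _ ≤ 8 * r₃ * (l ^ 2 + s ^ 2) ^ 2 * G := by gcongr
  have weaken : ∀ {P : ℝ}, 4 * l ^ 3 ≤ P * r₃ → r₃ ≤ l → 4 * l ^ 2 ≤ P := fun {P} h h' => by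
    refine le_of_mul_le_mul_right ?_ hr₃
    have := mul_le_mul_of_nonneg_left h' (by positivity : 0 ≤ 4 * l ^ 2)
    linarith
  rcases le_or_gt ((t₁ - s) ^ 2) (2 * l * r₁) with h₁ | h₁
  · rcases le_or_gt ((t₃ - s) ^ 2) (2 * l * r₃) with h₃ | h₃
    · have h := two_mul_le_of_sq_le hp hq hqp hl h₁ h₃ hII hE
      have h : 4 * l ^ 2 ≤ (t₁ - s) ^ 2 := by nlinarith
      refine ⟨fun _ => by linarith, fun h' => ?_⟩
      have h2 := mul_le_mul_of_nonneg_right (h.trans (le_sub_iff_add_le'.2 ht₁p)) hr₃.le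
      have := mul_le_mul_of_nonneg_left h' (by positivity : 0 ≤ 4 * l ^ 2)
      linarith
    · exfalso
      refine false_of_small (τ := t₃ ^ 2) (r₁ := r₁) hl hr₃ hσ (by linarith)
        (two_mul_sq_lt_of_lt hp hq hqp hl hr₃ h₁ h₃ hII) ?_ hG ?_
      · have : t₃ ^ 2 ≤ t₁ ^ 2 := by gcongr
        linarith
      · calc t₃ ^ 2 * (r₃ ^ 2 + t₃ ^ 2) * S ≤ t₁ ^ 2 * (r₃ ^ 2 + t₃ ^ 2) * S := by gcongr
          _ ≤ 8 * 1 * G := by linarith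
          _ ≤ 8 * (l ^ 2 + s ^ 2) ^ 2 * G := by gcongr
  · have h := pow_three_lt_of_lt hp hq hl hr₁ hr₃ h₁ hII
    have h2 := mul_le_mul_of_nonneg_right ht₁p hr₃.le
    exact ⟨fun h' => by linarith [weaken h.le h'], fun _ => by linarith⟩

/-- The scalar triple product of three vectors in Euclidean space. -/
def tripleProduct (a b c : EuclideanSpace ℝ (Fin 3)) : ℝ :=
  a 0 * (b 1 * c 2 - b 2 * c 1) - a 1 * (b 0 * c 2 - b 2 * c 0) + a 2 * (b 0 * c 1 - b 1 * c 0)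

section
variable {a b c v : EuclideanSpace ℝ (Fin 3)} {d r ρ : ℝ}

theorem real_inner_fin_three (x y : EuclideanSpace ℝ (Fin 3)) :
    inner ℝ x y = x 0 * y 0 + x 1 * y 1 + x 2 * y 2 := by
  simp [PiLp.inner_apply, Fin.sum_univ_three, mul_comm]

theorem norm_sq_fin_three (x : EuclideanSpace ℝ (Fin 3)) :
    ‖x‖ ^ 2 = x 0 ^ 2 + x 1 ^ 2 + x 2 ^ 2 := by
  rw [← real_inner_self_eq_norm_sq, real_inner_fin_three]; ring

theorem tripleProduct_sq (a b c : EuclideanSpace ℝ (Fin 3)) :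
    tripleProduct a b c ^ 2 = ‖a‖ ^ 2 * ‖b‖ ^ 2 * ‖c‖ ^ 2 +
      2 * inner ℝ a b * inner ℝ a c * inner ℝ b c - ‖a‖ ^ 2 * inner ℝ b c ^ 2 -
      ‖b‖ ^ 2 * inner ℝ a c ^ 2 - ‖c‖ ^ 2 * inner ℝ a b ^ 2 := by
  simp only [real_inner_fin_three, norm_sq_fin_three, tripleProduct]; ring

theorem exists_inner_eq_mul_tripleProduct (a b c : EuclideanSpace ℝ (Fin 3)) (p q w : ℝ) :
    ∃ v : EuclideanSpace ℝ (Fin 3), inner ℝ v a = p * tripleProduct a b c ∧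
      inner ℝ v b = q * tripleProduct a b c ∧ inner ℝ v c = w * tripleProduct a b c ∧
      ‖v‖ ^ 2 = p ^ 2 * (‖b‖ ^ 2 * ‖c‖ ^ 2 - inner ℝ b c ^ 2) +
        q ^ 2 * (‖a‖ ^ 2 * ‖c‖ ^ 2 - inner ℝ a c ^ 2) +
        w ^ 2 * (‖a‖ ^ 2 * ‖b‖ ^ 2 - inner ℝ a b ^ 2) +
        2 * (p * q * (inner ℝ a c * inner ℝ b c - inner ℝ a b * ‖c‖ ^ 2) +
          p * w * (inner ℝ a b * inner ℝ b c - inner ℝ a c * ‖b‖ ^ 2) +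
          q * w * (inner ℝ a b * inner ℝ a c - inner ℝ b c * ‖a‖ ^ 2)) := by
  refine ⟨!₂[p * (b 1 * c 2 - b 2 * c 1) + q * (c 1 * a 2 - c 2 * a 1) +
      w * (a 1 * b 2 - a 2 * b 1),
    p * (b 2 * c 0 - b 0 * c 2) + q * (c 2 * a 0 - c 0 * a 2) + w * (a 2 * b 0 - a 0 * b 2),
    p * (b 0 * c 1 - b 1 * c 0) + q * (c 0 * a 1 - c 1 * a 0) + w * (a 0 * b 1 - a 1 * b 0)],
    ?_, ?_, ?_, ?_⟩ <;>
  simp [real_inner_fin_three, norm_sq_fin_three, tripleProduct] <;> ring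

theorem exists_ne_zero_inner_eq_zero (f : Fin 3 → EuclideanSpace ℝ (Fin 3))
    (hf : (Matrix.of fun i j => f i j).det = 0) :
    ∃ v : EuclideanSpace ℝ (Fin 3), v ≠ 0 ∧ ∀ i, inner ℝ v (f i) = 0 := by
  obtain ⟨x, hx, h⟩ := Matrix.exists_mulVec_eq_zero_iff.2 hf
  refine ⟨WithLp.toLp 2 x, fun h0 => hx (by simpa using h0), fun i => ?_⟩
  have := congrFun h i
  simp only [Matrix.mulVec, dotProduct, Fin.sum_univ_three, Matrix.of_apply, Pi.zero_apply] at this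
  rw [real_inner_fin_three]
  simp only
  linarith

theorem smul_notMem_closedBall_of_neg (hr : r < 0) (t : ℝ) : t • v ∉ Metric.closedBall a r := by
  simp [Metric.closedBall_eq_empty.2 hr]

theorem smul_notMem_closedBall (h : inner ℝ v a ^ 2 < (‖a‖ ^ 2 - r ^ 2) * ‖v‖ ^ 2) (t : ℝ) :
    t • v ∉ Metric.closedBall a r := by
  intro hm
  rw [Metric.mem_closedBall, dist_eq_norm] at hm
  have h1 : ‖t • v - a‖ ^ 2 ≤ r ^ 2 := by gcongr
  rw [norm_sub_sq_real, inner_smul_left, norm_smul, mul_pow, Real.norm_eq_abs, sq_abs] at h1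
  simp only [conj_trivial] at h1
  have h2 := mul_le_mul_of_nonneg_right h1 (sq_nonneg ‖v‖)
  nlinarith [sq_nonneg (t * ‖v‖ ^ 2 - inner ℝ v a)]

theorem inner_le_of_add_le_dist (hr : 0 ≤ r) (hρ : 0 ≤ ρ) (h : r + ρ ≤ dist a b) :
    2 * inner ℝ a b ≤ (‖a‖ ^ 2 - r ^ 2) + (‖b‖ ^ 2 - ρ ^ 2) - 2 * r * ρ := by
  have h1 : (r + ρ) ^ 2 ≤ ‖a - b‖ ^ 2 := by rw [← dist_eq_norm]; gcongr
  rw [norm_sub_sq_real] at h1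
  linarith

theorem one_le_norm_sq_of_ellipsoid (hd : 1 < d) (ha : a 0 ^ 2 / d ^ 2 + a 1 ^ 2 + a 2 ^ 2 = 1) :
    1 ≤ ‖a‖ ^ 2 := by
  have : a 0 ^ 2 / d ^ 2 ≤ a 0 ^ 2 := div_le_self (sq_nonneg _) (one_le_pow₀ hd.le)
  rw [norm_sq_fin_three]
  linarith

theorem norm_sq_le_of_ellipsoid (hd : 1 < d) (ha : a 0 ^ 2 / d ^ 2 + a 1 ^ 2 + a 2 ^ 2 = 1) :
    ‖a‖ ^ 2 ≤ d ^ 2 := by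
  have h : d ^ 2 * (a 0 ^ 2 / d ^ 2) = a 0 ^ 2 := by field_simp
  have hd2 : 1 ≤ d ^ 2 := one_le_pow₀ hd.le
  rw [norm_sq_fin_three]
  nlinarith [mul_nonneg (sub_nonneg.2 hd2) (add_nonneg (sq_nonneg (a 1)) (sq_nonneg (a 2)))]

/-- The distance from a point of the ellipsoid to the plane spanned by two others is at most
`d` divided by the distance of either of them to the origin. -/
theorem norm_sq_mul_tripleProduct_sq_le (hd : 1 < d)
    (ha : a 0 ^ 2 / d ^ 2 + a 1 ^ 2 + a 2 ^ 2 = 1)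
    (hc : c 0 ^ 2 / d ^ 2 + c 1 ^ 2 + c 2 ^ 2 = 1) :
    ‖c‖ ^ 2 * tripleProduct a b c ^ 2 ≤ d ^ 2 * (‖b‖ ^ 2 * ‖c‖ ^ 2 - inner ℝ b c ^ 2) := by
  have hd0 : d ≠ 0 := by positivity
  simp only [real_inner_fin_three, norm_sq_fin_three, tripleProduct]
  obtain ⟨x₁, h₁⟩ : ∃ x, a 0 = d * x := ⟨a 0 / d, by field_simp⟩
  obtain ⟨x₂, h₂⟩ : ∃ x, b 0 = d * x := ⟨b 0 / d, by field_simp⟩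
  obtain ⟨x₃, h₃⟩ : ∃ x, c 0 = d * x := ⟨c 0 / d, by field_simp⟩
  rw [h₁, mul_pow, mul_div_cancel_left₀ _ (by positivity)] at ha
  rw [h₃, mul_pow, mul_div_cancel_left₀ _ (by positivity)] at hc
  rw [h₁, h₂, h₃]
  generalize a 1 = y₁ at *
  generalize a 2 = z₁ at *
  generalize b 1 = y₂ at *
  generalize b 2 = z₂ at *
  generalize c 1 = y₃ at *
  generalize c 2 = z₃ at *
  set m₀ := y₂ * z₃ - z₂ * y₃ with hm₀
  set m₁ := z₂ * x₃ - x₂ * z₃ with hm₁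
  set m₂ := x₂ * y₃ - y₂ * x₃ with hm₂
  have hcs : (x₁ * m₀ + y₁ * m₁ + z₁ * m₂) ^ 2 ≤ m₀ ^ 2 + m₁ ^ 2 + m₂ ^ 2 := by
    have : 0 ≤ (x₁ * m₁ - y₁ * m₀) ^ 2 + (x₁ * m₂ - z₁ * m₀) ^ 2 + (y₁ * m₂ - z₁ * m₁) ^ 2 := by
      positivity
    linear_combination this + (m₀ ^ 2 + m₁ ^ 2 + m₂ ^ 2) * ha
  have hd2 : 0 ≤ d ^ 2 - 1 := by nlinarith
  have horth : m₀ * x₃ + m₁ * y₃ + m₂ * z₃ = 0 := by rw [hm₀, hm₁, hm₂]; ring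
  have hS : (d ^ 2 * x₃ ^ 2 + y₃ ^ 2 + z₃ ^ 2) * (m₀ ^ 2 + m₁ ^ 2 + m₂ ^ 2) ≤
      m₀ ^ 2 + d ^ 2 * (m₁ ^ 2 + m₂ ^ 2) := by
    have := mul_nonneg hd2 (sq_nonneg (m₁ * z₃ - m₂ * y₃))
    linear_combination this + (m₀ ^ 2 + d ^ 2 * (m₁ ^ 2 + m₂ ^ 2)) * hc +
      (d ^ 2 - 1) * (m₀ * x₃ - m₁ * y₃ - m₂ * z₃) * horth
  have hL : 0 ≤ d ^ 2 * x₃ ^ 2 + y₃ ^ 2 + z₃ ^ 2 := by positivity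
  have := mul_le_mul_of_nonneg_left ((mul_le_mul_of_nonneg_left hcs hL).trans hS) (sq_nonneg d)
  rw [hm₀, hm₁, hm₂] at this
  linarith

end

/-- The Gram data of three vectors, together with the averaged inequality `h`, force the vector
`a` not to have a degenerate ball. -/
theorem lt_of_gram {La Lb Lc A B C τa τb τc D : ℝ} (hLc : 0 < Lc) (hD : 0 < D)
    (hDeq : D = La * Lb * Lc + 2 * A * B * C - La * C ^ 2 - Lb * B ^ 2 - Lc * A ^ 2)
    (hbc : 0 ≤ Lb * Lc - C ^ 2) (hab : 0 ≤ La * Lb - A ^ 2)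
    (hτb : 0 < τb) (hτc : 0 < τc)
    (h : τa * (Lb * Lc - C ^ 2) + τb * (La * Lc - B ^ 2) + τc * (La * Lb - A ^ 2) ≤ D) :
    τa < La := by
  have h1 : Lc * D ≤ (La * Lc - B ^ 2) * (Lb * Lc - C ^ 2) := by
    have := sq_nonneg (B * C - A * Lc)
    rw [hDeq]
    linarith
  have h2 : 0 < (La * Lc - B ^ 2) * (Lb * Lc - C ^ 2) := (mul_pos hLc hD).trans_le h1
  have h3 : 0 < La * Lc - B ^ 2 := pos_of_mul_pos_left h2 hbc
  have h4 : D ≤ La * (Lb * Lc - C ^ 2) := by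
    refine le_of_mul_le_mul_left ?_ hLc
    have := mul_nonneg hbc (sq_nonneg B)
    linarith
  have h5 := mul_pos hτb h3
  have h6 := mul_nonneg hτc.le hab
  refine lt_of_mul_lt_mul_right ?_ hbc
  linarith

theorem volume_of_gram {La Lb Lc A B C τa τb τc D k : ℝ} (hLc : 0 < Lc) (hD : 0 < D)
    (hDeq : D = La * Lb * Lc + 2 * A * B * C - La * C ^ 2 - Lb * B ^ 2 - Lc * A ^ 2)
    (hbc : 0 < Lb * Lc - C ^ 2) (hτa : 0 < τa) (hτb : 0 < τb) (hτc : 0 < τc)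
    (hk : Lc * D ≤ k * (Lb * Lc - C ^ 2))
    (h : τa * (Lb * Lc - C ^ 2) + τb * (La * Lc - B ^ 2) + τc * (La * Lb - A ^ 2) ≤ D) :
    τa * (Lb * Lc - C ^ 2) * Lc ≤ k * (Lb * Lc - C ^ 2 - τb * Lc - τc * Lb) := by
  have h1 : Lc * D ≤ (La * Lc - B ^ 2) * (Lb * Lc - C ^ 2) := by
    have := sq_nonneg (B * C - A * Lc)
    rw [hDeq]
    linarith
  have h2 : Lb * D ≤ (La * Lb - A ^ 2) * (Lb * Lc - C ^ 2) := by
    have := sq_nonneg (A * C - B * Lb)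
    rw [hDeq]
    linarith
  set S := Lb * Lc - C ^ 2
  have h3 : τa * S * S ≤ D * (S - τb * Lc - τc * Lb) := by
    have := mul_le_mul_of_nonneg_right h hbc.le
    have := mul_le_mul_of_nonneg_left h1 hτb.le
    have := mul_le_mul_of_nonneg_left h2 hτc.le
    linarith
  have h4 : 0 < S - τb * Lc - τc * Lb :=
    pos_of_mul_pos_right ((by positivity : 0 < τa * S * S).trans_le h3) hD.le
  refine le_of_mul_le_mul_right ?_ hbc
  have := mul_le_mul_of_nonneg_left h3 hLc.le
  have := mul_le_mul_of_nonneg_right hk h4.le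
  linarith

theorem norm_sq_mul_norm_sq_sub_inner_sq_nonneg (x y : EuclideanSpace ℝ (Fin 3)) :
    0 ≤ ‖x‖ ^ 2 * ‖y‖ ^ 2 - inner ℝ x y ^ 2 := by
  have := sq_le_sq' (by linarith [neg_abs_le (inner ℝ x y), abs_real_inner_le_norm x y])
    ((le_abs_self _).trans (abs_real_inner_le_norm x y))
  linarith [mul_pow ‖x‖ ‖y‖ 2]

theorem exists_sq_eq_one_mul_eq_abs (x : ℝ) : ∃ e : ℝ, e ^ 2 = 1 ∧ e * x = |x| := by
  rcases abs_cases x with ⟨h, -⟩ | ⟨h, -⟩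
  · exact ⟨1, by norm_num, by rw [h]; ring⟩
  · exact ⟨-1, by norm_num, by rw [h]; ring⟩

/-- Three balls with linearly independent centers on the ellipsoid, sorted by the lengths of the
tangents from the origin, are all missed by some line through the origin. -/
theorem exists_inner_sq_lt_of_sorted {a b c : EuclideanSpace ℝ (Fin 3)} {d ra rb rc : ℝ}
    (hd : 1 < d) (hd8 : d ^ 2 ≤ 8)
    (ha : a 0 ^ 2 / d ^ 2 + a 1 ^ 2 + a 2 ^ 2 = 1) (hb : b 0 ^ 2 / d ^ 2 + b 1 ^ 2 + b 2 ^ 2 = 1)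
    (hc : c 0 ^ 2 / d ^ 2 + c 1 ^ 2 + c 2 ^ 2 = 1)
    (hra : 0 ≤ ra) (hrb : 0 ≤ rb) (hrc : 0 ≤ rc)
    (hab : ra + rb ≤ dist a b) (hac : ra + rc ≤ dist a c) (hbc : rb + rc ≤ dist b c)
    (hτb : 0 < ‖b‖ ^ 2 - rb ^ 2) (hτbc : ‖b‖ ^ 2 - rb ^ 2 ≤ ‖c‖ ^ 2 - rc ^ 2)
    (hτca : ‖c‖ ^ 2 - rc ^ 2 ≤ ‖a‖ ^ 2 - ra ^ 2) (hΔ : tripleProduct a b c ≠ 0) :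
    ∃ v : EuclideanSpace ℝ (Fin 3), v ≠ 0 ∧
      inner ℝ v a ^ 2 < (‖a‖ ^ 2 - ra ^ 2) * ‖v‖ ^ 2 ∧
      inner ℝ v b ^ 2 < (‖b‖ ^ 2 - rb ^ 2) * ‖v‖ ^ 2 ∧
      inner ℝ v c ^ 2 < (‖c‖ ^ 2 - rc ^ 2) * ‖v‖ ^ 2 := by
  by_contra! hno
  have hτc : 0 < ‖c‖ ^ 2 - rc ^ 2 := hτb.trans_le hτbc
  have hτa : 0 < ‖a‖ ^ 2 - ra ^ 2 := hτc.trans_le hτca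
  have hIab := inner_le_of_add_le_dist hra hrb hab
  have hIac := inner_le_of_add_le_dist hra hrc hac
  have hIbc := inner_le_of_add_le_dist hrb hrc hbc
  obtain ⟨t₁, ht₁, hta⟩ : ∃ t : ℝ, 0 < t ∧ t ^ 2 = ‖a‖ ^ 2 - ra ^ 2 :=
    ⟨√_, Real.sqrt_pos.2 hτa, Real.sq_sqrt hτa.le⟩
  obtain ⟨s, hs, htb⟩ : ∃ t : ℝ, 0 < t ∧ t ^ 2 = ‖b‖ ^ 2 - rb ^ 2 :=
    ⟨√_, Real.sqrt_pos.2 hτb, Real.sq_sqrt hτb.le⟩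
  obtain ⟨t₃, ht₃, htc⟩ : ∃ t : ℝ, 0 < t ∧ t ^ 2 = ‖c‖ ^ 2 - rc ^ 2 :=
    ⟨√_, Real.sqrt_pos.2 hτc, Real.sq_sqrt hτc.le⟩
  set Δ := tripleProduct a b c with hΔdef
  have hD : 0 < Δ ^ 2 := by positivity
  have hblock : ∀ v : EuclideanSpace ℝ (Fin 3), inner ℝ v a ^ 2 = t₁ ^ 2 * Δ ^ 2 →
      inner ℝ v b ^ 2 = s ^ 2 * Δ ^ 2 → inner ℝ v c ^ 2 = t₃ ^ 2 * Δ ^ 2 →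
      ‖v‖ ^ 2 ≤ Δ ^ 2 := by
    intro v h₁ h₂ h₃
    by_contra! hlt
    have hv : v ≠ 0 := by
      rintro rfl
      simp at hlt
      linarith
    rw [← hta, ← htb, ← htc] at hno
    have h := hno v hv (by rw [h₁]; gcongr) (by rw [h₂]; gcongr)
    rw [h₃] at h
    exact (mul_lt_mul_of_pos_left hlt (by positivity : 0 < t₃ ^ 2)).not_ge h
  have hF : (‖a‖ ^ 2 - ra ^ 2) * (‖b‖ ^ 2 * ‖c‖ ^ 2 - inner ℝ b c ^ 2) +
      (‖b‖ ^ 2 - rb ^ 2) * (‖a‖ ^ 2 * ‖c‖ ^ 2 - inner ℝ a c ^ 2) +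
      (‖c‖ ^ 2 - rc ^ 2) * (‖a‖ ^ 2 * ‖b‖ ^ 2 - inner ℝ a b ^ 2) ≤ Δ ^ 2 := by
    have key : ∀ e f : ℝ, e ^ 2 = 1 → f ^ 2 = 1 →
        t₁ ^ 2 * (‖b‖ ^ 2 * ‖c‖ ^ 2 - inner ℝ b c ^ 2) +
          (e * s) ^ 2 * (‖a‖ ^ 2 * ‖c‖ ^ 2 - inner ℝ a c ^ 2) +
          (f * t₃) ^ 2 * (‖a‖ ^ 2 * ‖b‖ ^ 2 - inner ℝ a b ^ 2) +
          2 * (t₁ * (e * s) * (inner ℝ a c * inner ℝ b c - inner ℝ a b * ‖c‖ ^ 2) +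
            t₁ * (f * t₃) * (inner ℝ a b * inner ℝ b c - inner ℝ a c * ‖b‖ ^ 2) +
            e * s * (f * t₃) * (inner ℝ a b * inner ℝ a c - inner ℝ b c * ‖a‖ ^ 2)) ≤ Δ ^ 2 := by
      intro e f he hf
      obtain ⟨v, h₁, h₂, h₃, hv⟩ := exists_inner_eq_mul_tripleProduct a b c t₁ (e * s) (f * t₃)
      have := hblock v (by rw [h₁]; ring) (by rw [h₂]; linear_combination s ^ 2 * Δ ^ 2 * he)
        (by rw [h₃]; linear_combination t₃ ^ 2 * Δ ^ 2 * hf)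
      rwa [hv] at this
    have h₁ := key 1 1 (by norm_num) (by norm_num)
    have h₂ := key 1 (-1) (by norm_num) (by norm_num)
    have h₃ := key (-1) 1 (by norm_num) (by norm_num)
    have h₄ := key (-1) (-1) (by norm_num) (by norm_num)
    rw [← hta, ← htb, ← htc]
    linarith
  have hB : ∀ x y z : ℝ, (|x| * t₁ + |y| * s + |z| * t₃) ^ 2 ≤
      x ^ 2 * ‖a‖ ^ 2 + y ^ 2 * ‖b‖ ^ 2 + z ^ 2 * ‖c‖ ^ 2 +
        2 * (x * y * inner ℝ a b + x * z * inner ℝ a c + y * z * inner ℝ b c) := by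
    intro x y z
    obtain ⟨e₁, he₁, hx⟩ := exists_sq_eq_one_mul_eq_abs x
    obtain ⟨e₂, he₂, hy⟩ := exists_sq_eq_one_mul_eq_abs y
    obtain ⟨e₃, he₃, hz⟩ := exists_sq_eq_one_mul_eq_abs z
    obtain ⟨v, h₁, h₂, h₃, -⟩ :=
      exists_inner_eq_mul_tripleProduct a b c (e₁ * t₁) (e₂ * s) (e₃ * t₃)
    have hle := hblock v (by rw [h₁]; linear_combination t₁ ^ 2 * Δ ^ 2 * he₁)
      (by rw [h₂]; linear_combination s ^ 2 * Δ ^ 2 * he₂)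
      (by rw [h₃]; linear_combination t₃ ^ 2 * Δ ^ 2 * he₃)
    have hcs := norm_sq_mul_norm_sq_sub_inner_sq_nonneg v (x • a + y • b + z • c)
    have hin : inner ℝ v (x • a + y • b + z • c) = (|x| * t₁ + |y| * s + |z| * t₃) * Δ := by
      rw [inner_add_right, inner_add_right, inner_smul_right, inner_smul_right, inner_smul_right,
        h₁, h₂, h₃, ← hx, ← hy, ← hz]
      ring
    have hnorm : ‖x • a + y • b + z • c‖ ^ 2 =
        x ^ 2 * ‖a‖ ^ 2 + y ^ 2 * ‖b‖ ^ 2 + z ^ 2 * ‖c‖ ^ 2 +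
        2 * (x * y * inner ℝ a b + x * z * inner ℝ a c + y * z * inner ℝ b c) := by
      simp only [norm_sq_fin_three, real_inner_fin_three, PiLp.add_apply, PiLp.smul_apply,
        smul_eq_mul]
      ring
    rw [← hnorm]
    refine le_of_mul_le_mul_right ?_ hD
    have := mul_le_mul_of_nonneg_right hle (sq_nonneg ‖x • a + y • b + z • c‖)
    rw [hin] at hcs
    linarith
  have hDeq := tripleProduct_sq a b c
  rw [← hΔdef] at hDeq
  have hLa := one_le_norm_sq_of_ellipsoid hd ha
  have hLb := one_le_norm_sq_of_ellipsoid hd hb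
  have hLc := one_le_norm_sq_of_ellipsoid hd hc
  have hSab := norm_sq_mul_norm_sq_sub_inner_sq_nonneg a b
  have hSac := norm_sq_mul_norm_sq_sub_inner_sq_nonneg a c
  have hSbc := norm_sq_mul_norm_sq_sub_inner_sq_nonneg b c
  have hk := norm_sq_mul_tripleProduct_sq_le (b := b) hd ha hc
  rw [← hΔdef] at hk
  have hk8 : ‖c‖ ^ 2 * Δ ^ 2 ≤ 8 * (‖b‖ ^ 2 * ‖c‖ ^ 2 - inner ℝ b c ^ 2) :=
    hk.trans (by gcongr)
  have hS : 0 < ‖b‖ ^ 2 * ‖c‖ ^ 2 - inner ℝ b c ^ 2 := by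
    have : 0 < ‖c‖ ^ 2 * Δ ^ 2 := by positivity
    linarith
  have hV := volume_of_gram (by linarith) hD hDeq hS hτa hτb hτc hk8 hF
  have hra' : 0 < ra := by
    have := lt_of_gram (by linarith) hD hDeq hSbc hSab hτb hτc hF
    exact hra.lt_of_ne' (by rintro rfl; linarith)
  have hrb' : 0 < rb := by
    have := lt_of_gram (La := ‖b‖ ^ 2) (Lb := ‖a‖ ^ 2) (Lc := ‖c‖ ^ 2) (A := inner ℝ a b)
      (B := inner ℝ b c) (C := inner ℝ a c) (τa := ‖b‖ ^ 2 - rb ^ 2)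
      (by linarith) hD (by rw [hDeq]; ring) hSac (by linarith) hτa hτc (by linarith)
    exact hrb.lt_of_ne' (by rintro rfl; linarith)
  have hrc' : 0 < rc := by
    have := lt_of_gram (La := ‖c‖ ^ 2) (Lb := ‖b‖ ^ 2) (Lc := ‖a‖ ^ 2) (A := inner ℝ b c)
      (B := inner ℝ a c) (C := inner ℝ a b) (τa := ‖c‖ ^ 2 - rc ^ 2)
      (by linarith) hD (by rw [hDeq]; ring) (by linarith) (by linarith) hτb hτa (by linarith)
    exact hrc.lt_of_ne' (by rintro rfl; linarith)
  have hLa' : ra ^ 2 + t₁ ^ 2 = ‖a‖ ^ 2 := by linarith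
  have hLb' : rb ^ 2 + s ^ 2 = ‖b‖ ^ 2 := by linarith
  have hLc' : rc ^ 2 + t₃ ^ 2 = ‖c‖ ^ 2 := by linarith
  refine false_of_block (A := inner ℝ a b) (B := inner ℝ a c) (C := inner ℝ b c) hs
    (abs_le_of_sq_le_sq' (by linarith) ht₃.le).2 (abs_le_of_sq_le_sq' (by linarith) ht₁.le).2
    hra' hrb' hrc' ?_ (by linarith) (by linarith) (by linarith) ?_ ?_ ?_ ?_ ?_
  · rwa [hLa', hLb', hLc']
  · rw [hLa']
    exact (norm_sq_le_of_ellipsoid hd ha).trans hd8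
  · rwa [hLb']
  · rwa [hLc']
  · rwa [hLb', hLc']
  · rw [hLb', hLc', hta]
    refine hV.trans_eq ?_
    rw [← hLb', ← hLc']
    ring

theorem det_of_eq_tripleProduct (f : Fin 3 → EuclideanSpace ℝ (Fin 3)) :
    (Matrix.of fun i j => f i j).det = tripleProduct (f 0) (f 1) (f 2) := by
  rw [Matrix.det_fin_three]
  simp only [Matrix.of_apply, tripleProduct]
  ring

/-- For `1 < d ≤ 2√2`, no three pairwise non-overlapping closed balls with centers on
the prolate ellipsoid with semi-axes `d, 1, 1`, none containing the origin, generate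
the shadow at the origin. -/
theorem no_shadow_three_closed_balls_of_ratio_le
    (d : ℝ) (hd1 : 1 < d) (hd2 : d ≤ 2 * Real.sqrt 2)
    (a : Fin 3 → EuclideanSpace ℝ (Fin 3)) (r : Fin 3 → ℝ)
    (ha : ∀ i, (a i 0) ^ 2 / d ^ 2 + (a i 1) ^ 2 + (a i 2) ^ 2 = 1)
    (hsep : ∀ i j, i ≠ j → r i + r j ≤ dist (a i) (a j))
    (h0 : ∀ i, (0 : EuclideanSpace ℝ (Fin 3)) ∉ Metric.closedBall (a i) (r i)) :
    ∃ v : EuclideanSpace ℝ (Fin 3), v ≠ 0 ∧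
      ∀ (t : ℝ) (i : Fin 3), t • v ∉ Metric.closedBall (a i) (r i) := by
  have hd8 : d ^ 2 ≤ 8 := by
    have h : d ^ 2 ≤ (2 * √2) ^ 2 := by gcongr
    rwa [mul_pow, Real.sq_sqrt (by norm_num), show (2 : ℝ) ^ 2 * 2 = 8 by norm_num] at h
  have hr : ∀ i, r i < ‖a i‖ := fun i => by simpa using h0 i
  have hτ : ∀ i, 0 ≤ r i → 0 < ‖a i‖ ^ 2 - r i ^ 2 := fun i hi =>
    sub_pos.2 (pow_lt_pow_left₀ (hr i) hi two_ne_zero)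
  have hmiss : ∀ v : EuclideanSpace ℝ (Fin 3), v ≠ 0 → ∀ i, inner ℝ v (a i) = 0 → ∀ t : ℝ,
      t • v ∉ Metric.closedBall (a i) (r i) := by
    intro v hv i hi t
    rcases lt_or_ge (r i) 0 with hneg | hnn
    · exact smul_notMem_closedBall_of_neg hneg t
    · refine smul_notMem_closedBall ?_ t
      have := hτ i hnn
      rw [hi, zero_pow two_ne_zero]
      positivity
  by_cases hnn : ∀ i, 0 ≤ r i
  · obtain ⟨σ, hσ⟩ : ∃ σ : Equiv.Perm (Fin 3), Monotone fun i => ‖a (σ i)‖ ^ 2 - r (σ i) ^ 2 :=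
      ⟨_, Tuple.monotone_sort fun i => ‖a i‖ ^ 2 - r i ^ 2⟩
    by_cases hΔ : tripleProduct (a (σ 2)) (a (σ 0)) (a (σ 1)) = 0
    · obtain ⟨v, hv, h⟩ := exists_ne_zero_inner_eq_zero
        (fun i => a (σ (i + 2))) (by rw [det_of_eq_tripleProduct]; exact hΔ)
      refine ⟨v, hv, fun t i => hmiss v hv i ?_ t⟩
      simpa using h (σ.symm i - 2)
    · have hne : ∀ i j : Fin 3, i ≠ j → r (σ i) + r (σ j) ≤ dist (a (σ i)) (a (σ j)) :=
        fun i j hij => hsep _ _ (σ.injective.ne hij)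
      obtain ⟨v, hv, h₂, h₀, h₁⟩ := exists_inner_sq_lt_of_sorted hd1 hd8 (ha _) (ha _) (ha _)
        (hnn _) (hnn _) (hnn _) (hne 2 0 (by decide)) (hne 2 1 (by decide)) (hne 0 1 (by decide))
        (hτ _ (hnn _)) (hσ (by decide : (0 : Fin 3) ≤ 1)) (hσ (by decide : (1 : Fin 3) ≤ 2)) hΔ
      refine ⟨v, hv, fun t i => ?_⟩
      obtain ⟨m, rfl⟩ := σ.surjective i
      refine smul_notMem_closedBall ?_ t
      fin_cases m
      exacts [h₀, h₁, h₂]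
  · push Not at hnn
    obtain ⟨i, hi⟩ := hnn
    obtain ⟨v, hv, h⟩ := exists_ne_zero_inner_eq_zero (Function.update a i 0)
      (Matrix.det_eq_zero_of_row_eq_zero i fun j => by simp)
    refine ⟨v, hv, fun t j => ?_⟩
    rcases eq_or_ne j i with rfl | hji
    · exact smul_notMem_closedBall_of_neg hi t
    · exact hmiss v hv j (by simpa [hji] using h j) t
end
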